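/- arXiv:2201.08349 — 2 statements merged into one kernel-verified Lean document; each statement's English description precedes it below -/
import Mathlib

section
/- Let b > 0, β ∈ (1,2], ϑ ∈ (0,2), and let f satisfy Assumptions A0 and A2 (degenerate convexity) with parameters μ > 0, θ ≥ 0, N₂. Let π(x) = Z^{-1} e^{-f(x)} and define the nonlocal Dirichlet form E(φ) = ∬_{x ≠ y} (φ(x) − φ(y))² |x − y|^{−(d+ϑ)} dx π(y)dy. Then: (1) if θ < 2 − β, or θ = 2 − β and ϑ < μ β^{-1} b^{-1}, then π satisfies the super Poincaré inequality: there exists β̃ : (0,∞) → (0,∞) such that for every r > 0 and bounded measurable φ with E(φ) < ∞, ∫ φ² dπ ≤ r E(φ) + β̃(r) (∫|φ| dπ)²; (2) if θ = 2 − β and ϑ ≥ μ β^{-1} b^{-1}, or θ > 2 − β, then π satisfies the weak Poincaré inequality: there exists α̃ : (0,∞) → (0,∞) such that for every r > 0 and bounded measurable φ with E(φ) < ∞, Var_π(φ) ≤ α̃(r) E(φ) + r ‖φ‖_∞². -/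
open Filter MeasureTheory Set
open scoped RealInnerProductSpace Topology

noncomputable section
/-- The target probability density `π ∝ exp(−f)`. -/
def targetDensity (d : ℕ) (f : EuclideanSpace ℝ (Fin d) → ℝ)
    (x : EuclideanSpace ℝ (Fin d)) : ℝ :=
  Real.exp (-(f x)) / ∫ z, Real.exp (-(f z))

/-- The nonlocal Dirichlet form
`E(φ) = ∬_{x≠y} (φ(x) − φ(y))² |x−y|^{−(d+ϑ)} dx π(y) dy`
associated with `ϑ`-stable driven diffusions. -/
def dirichletForm (d : ℕ) (ϑ : ℝ) (π φ : EuclideanSpace ℝ (Fin d) → ℝ) : ℝ :=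
  ∫ y, (∫ x, (φ x - φ y)^2 * ‖x - y‖ ^ (-((d:ℝ) + ϑ))) * π y

/-- Finiteness (integrability) of the nonlocal Dirichlet energy of `φ`. -/
def dirichletFinite (d : ℕ) (ϑ : ℝ) (π φ : EuclideanSpace ℝ (Fin d) → ℝ) : Prop :=
  Integrable (fun p : EuclideanSpace ℝ (Fin d) × EuclideanSpace ℝ (Fin d) =>
    (φ p.1 - φ p.2)^2 * ‖p.1 - p.2‖ ^ (-((d:ℝ) + ϑ)) * π p.2)

theorem hh_growth (D b β ϑ : ℝ) (hb : 0 < b) (hβ : β ∈ Ioc (1:ℝ) 2)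
    (f0 : ℝ → ℝ) (μ θ N2 : ℝ) (hμ : 0 < μ) (hθ : 0 ≤ θ)
    (hA2 : ∀ r : ℝ, N2 < r →
      μ / (1 + r^2 / 4) ^ (θ / 2) <
        deriv f0 (Real.exp (b * r ^ β)) * deriv (fun s => Real.exp (b * s ^ β)) r / r
          - b * β * D * r ^ (β - 2) + (D - β) * r ^ (-2 : ℝ))
    (hc : θ < 2 - β ∨ (θ = 2 - β ∧ ϑ < μ / (β * b))) :
    ∃ ε : ℝ, 0 < ε ∧ ∃ ρ0 : ℝ, 0 < ρ0 ∧ ∀ ρ, ρ0 ≤ ρ → D + ϑ + ε ≤ deriv f0 ρ * ρ := by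
  have hβ1 := hβ.1
  have hβ0 : 0 < β := by linarith
  have hbβ : 0 < b * β := by positivity
  have hdec : Tendsto (fun r : ℝ => |D - β| * r ^ (-β)) atTop (𝓝 (|D - β| * 0)) :=
    (tendsto_rpow_neg_atTop hβ0).const_mul _
  rw [mul_zero] at hdec
  have key : ∃ ε : ℝ, 0 < ε ∧
      ∀ᶠ r : ℝ in atTop, b * β * (ϑ + ε) ≤ μ * r ^ (2 - β - θ) - |D - β| * r ^ (-β) := by
    rcases hc with h | ⟨h, h2⟩
    · refine ⟨1, one_pos, ?_⟩
      have h1 : Tendsto (fun r : ℝ => μ * r ^ (2 - β - θ)) atTop atTop :=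
        (tendsto_rpow_atTop (by linarith)).const_mul_atTop hμ
      filter_upwards [h1.eventually_ge_atTop (b * β * (ϑ + 1) + 1),
        hdec.eventually_le_const one_pos] with r h3 h4
      linarith
    · refine ⟨(μ / (β * b) - ϑ) / 2, by linarith, ?_⟩
      have h5 : 0 < b * β * (μ / (β * b) - ϑ) / 2 := by
        have := mul_pos hbβ (sub_pos.2 h2); linarith
      have h6 : b * β * (μ / (β * b)) = μ := by field_simp
      filter_upwards [hdec.eventually_le_const h5] with r h4
      have : (2 - β - θ) = 0 := by linarith
      rw [this, Real.rpow_zero]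
      nlinarith
  obtain ⟨ε, hε, hev⟩ := key
  refine ⟨ε, hε, ?_⟩
  have main : ∀ᶠ r : ℝ in atTop,
      D + ϑ + ε ≤ deriv f0 (Real.exp (b * r ^ β)) * Real.exp (b * r ^ β) := by
    filter_upwards [hev, eventually_gt_atTop N2, eventually_ge_atTop 2] with r h1 h2 h3
    have hr : 0 < r := by linarith
    have hA := hA2 r h2
    have hder : deriv (fun s => Real.exp (b * s ^ β)) r
        = Real.exp (b * r ^ β) * (b * (β * r ^ (β - 1))) :=
      (((Real.hasDerivAt_rpow_const (Or.inl hr.ne')).const_mul b).exp).deriv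
    rw [hder] at hA
    have e1 : (1 + r^2/4) ^ (θ/2) ≤ r ^ θ := by
      calc (1 + r^2/4) ^ (θ/2) ≤ (r^2) ^ (θ/2) := by
            apply Real.rpow_le_rpow (by positivity) (by nlinarith) (by linarith)
        _ = r ^ θ := by
            rw [← Real.rpow_natCast r 2, ← Real.rpow_mul hr.le]; congr 1; push_cast; ring
    have e2 : μ * r ^ (-θ) ≤ μ / (1 + r^2/4) ^ (θ/2) := by
      rw [Real.rpow_neg hr.le, ← div_eq_mul_inv]
      exact div_le_div_of_nonneg_left hμ.le (by positivity) e1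
    have e3 : r ^ (β - 1) = r ^ (β-2) * r := by
      rw [← Real.rpow_add_one hr.ne']; congr 1; ring
    have e4 : r ^ (2 - β - θ) * r ^ (β - 2) = r ^ (-θ) := by
      rw [← Real.rpow_add hr]; congr 1; ring
    have e5 : r ^ (-β) * r ^ (β - 2) = r ^ (-2:ℝ) := by
      rw [← Real.rpow_add hr]; congr 1; ring
    have hq : 0 < r ^ (β - 2) := by positivity
    have hs : 0 < r ^ (-2:ℝ) := by positivity
    have h7 := mul_le_mul_of_nonneg_right h1 hq.le
    rw [sub_mul, mul_assoc μ, e4, mul_assoc |D - β|, e5] at h7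
    have h8 : (D - β) * r ^ (-2:ℝ) ≤ |D - β| * r ^ (-2:ℝ) :=
      mul_le_mul_of_nonneg_right (le_abs_self _) hs.le
    have h9 : deriv f0 (Real.exp (b * r ^ β)) * (Real.exp (b * r ^ β) * (b * (β * r ^ (β - 1)))) / r
        = b * β * (deriv f0 (Real.exp (b * r ^ β)) * Real.exp (b * r ^ β)) * r ^ (β-2) := by
      rw [e3]; field_simp
    rw [h9] at hA
    have h10 : (b * β * r ^ (β-2)) * (D + ϑ + ε) ≤ (b * β * r ^ (β-2)) *
        (deriv f0 (Real.exp (b * r ^ β)) * Real.exp (b * r ^ β)) := by nlinarith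
    exact le_of_mul_le_mul_left h10 (by positivity)
  have ht : Tendsto (fun ρ : ℝ => (Real.log ρ / b) ^ (1/β)) atTop atTop :=
    (tendsto_rpow_atTop (by positivity)).comp (Real.tendsto_log_atTop.atTop_div_const hb)
  have hall : ∀ᶠ ρ : ℝ in atTop, D + ϑ + ε ≤ deriv f0 ρ * ρ := by
    filter_upwards [ht.eventually main, eventually_gt_atTop 1] with ρ h1 h2
    have hl : 0 < Real.log ρ := Real.log_pos h2
    have : Real.exp (b * ((Real.log ρ / b) ^ (1/β)) ^ β) = ρ := by
      rw [← Real.rpow_mul (by positivity), one_div_mul_cancel hβ0.ne', Real.rpow_one,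
        mul_div_cancel₀ _ hb.ne', Real.exp_log (by linarith)]
    rwa [this] at h1
  obtain ⟨a, ha⟩ := eventually_atTop.1 hall
  exact ⟨max a 1, by positivity, fun ρ h => ha ρ (le_trans (le_max_left _ _) h)⟩

theorem hh_decay (f0 : ℝ → ℝ) (hf0 : ContDiff ℝ 2 f0) (k ε ρ0 : ℝ) (hε : 0 < ε) (hρ0 : 0 < ρ0)
    (h : ∀ ρ, ρ0 ≤ ρ → k + ε ≤ deriv f0 ρ * ρ) :
    Tendsto (fun ρ : ℝ => Real.exp (-f0 ρ) * ρ ^ k) atTop (𝓝 0) := by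
  have hd : Differentiable ℝ f0 := hf0.differentiable (by norm_num)
  have hder : ∀ ρ, 0 < ρ →
      HasDerivAt (fun x => f0 x - (k+ε) * Real.log x) (deriv f0 ρ - (k+ε) * ρ⁻¹) ρ := fun ρ hρ =>
    (hd ρ).hasDerivAt.sub ((Real.hasDerivAt_log hρ.ne').const_mul _)
  have hm : MonotoneOn (fun x => f0 x - (k+ε) * Real.log x) (Ici ρ0) := by
    apply monotoneOn_of_deriv_nonneg (convex_Ici _)
    · exact fun x hx => (hder x (lt_of_lt_of_le hρ0 hx)).continuousAt.continuousWithinAt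
    · intro x hx
      rw [interior_Ici] at hx
      exact (hder x (hρ0.trans hx)).differentiableAt.differentiableWithinAt
    · intro x hx
      rw [interior_Ici] at hx
      have hx0 : 0 < x := hρ0.trans hx
      rw [(hder x hx0).deriv, ← div_eq_mul_inv, sub_nonneg, div_le_iff₀ hx0]
      exact h x (le_of_lt hx)
  set c := f0 ρ0 - (k+ε) * Real.log ρ0 with hc
  have hlim : Tendsto (fun ρ : ℝ => Real.exp (-c) * ρ ^ (-ε)) atTop (𝓝 (Real.exp (-c) * 0)) :=
    (tendsto_rpow_neg_atTop hε).const_mul _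
  rw [mul_zero] at hlim
  refine tendsto_of_tendsto_of_tendsto_of_le_of_le' tendsto_const_nhds hlim ?_ ?_
  · filter_upwards [eventually_gt_atTop 0] with ρ hρ
    positivity
  · filter_upwards [eventually_ge_atTop ρ0] with ρ hρ
    have hρ' : 0 < ρ := lt_of_lt_of_le hρ0 hρ
    have := hm (mem_Ici.2 le_rfl) hρ hρ
    simp only at this
    rw [Real.rpow_def_of_pos hρ', Real.rpow_def_of_pos hρ', ← Real.exp_add, ← Real.exp_add]
    apply Real.exp_le_exp.2
    nlinarith

/-- integrability and value of the form as a double integral -/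
theorem hh_form {d : ℕ} (ϑ : ℝ) (p φ : EuclideanSpace ℝ (Fin d) → ℝ)
    (hfin : dirichletFinite d ϑ p φ) :
    dirichletForm d ϑ p φ = ∫ q : EuclideanSpace ℝ (Fin d) × EuclideanSpace ℝ (Fin d),
      (φ q.1 - φ q.2)^2 * ‖q.1 - q.2‖ ^ (-((d:ℝ) + ϑ)) * p q.2 := by
  unfold dirichletForm dirichletFinite at *
  rw [Measure.volume_eq_prod] at hfin ⊢
  rw [integral_prod_symm _ hfin]
  congr 1; ext y
  rw [← integral_mul_const]

theorem hh_core {d : ℕ} (ϑ : ℝ) (p φ : EuclideanSpace ℝ (Fin d) → ℝ)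
    (hp : Integrable p) (hp0 : ∀ x, 0 < p x) (hφ : Measurable φ)
    (hbd : ∃ Cb : ℝ, ∀ x, |φ x| ≤ Cb) (hfin : dirichletFinite d ϑ p φ)
    (A : Set (EuclideanSpace ℝ (Fin d))) (hA : MeasurableSet A)
    (S : Set (EuclideanSpace ℝ (Fin d) × EuclideanSpace ℝ (Fin d))) (hS : MeasurableSet S)
    (v c m : ℝ) (hm : 0 < m) (hc : 0 ≤ c)
    (hv : ∀ x, (volume.real {y | (x, y) ∈ S}) = A.indicator (fun _ => v) x)
    (hvf : ∀ x, volume {y | (x, y) ∈ S} ≠ ⊤)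
    (hSc : ∀ x y, (x, y) ∈ S → x ≠ y → p x ≤ c * (‖x - y‖ ^ (-((d:ℝ) + ϑ)) * p y))
    (hSm : ∀ x y, (x, y) ∈ S → m ≤ p y) :
    v * ∫ x in A, (φ x)^2 * p x ≤ c * dirichletForm d ϑ p φ
      + 2 / m * (∫ x, |φ x| * p x)^2 := by
  obtain ⟨Cb, hCb⟩ := hbd
  have hCb0 : 0 ≤ Cb := (abs_nonneg _).trans (hCb 0)
  rw [hh_form ϑ p φ hfin]
  unfold dirichletFinite at hfin
  have i1 : Integrable (fun x => |φ x| * p x) :=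
    hp.bdd_mul (c := Cb) hφ.abs.aestronglyMeasurable
      (Eventually.of_forall fun x => by simpa using hCb x)
  have i2 : Integrable (fun q : EuclideanSpace ℝ (Fin d) × EuclideanSpace ℝ (Fin d) =>
      (|φ q.1| * p q.1) * (|φ q.2| * p q.2)) := i1.mul_prod i1
  have e2 : (∫ x, |φ x| * p x)^2 = ∫ q : EuclideanSpace ℝ (Fin d) × EuclideanSpace ℝ (Fin d),
      (|φ q.1| * p q.1) * (|φ q.2| * p q.2) := by
    rw [Measure.volume_eq_prod, integral_prod_mul (fun x => |φ x| * p x) (fun x => |φ x| * p x), sq]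
  have hpt : ∀ q : EuclideanSpace ℝ (Fin d) × EuclideanSpace ℝ (Fin d),
      S.indicator (fun q => (φ q.1)^2 * p q.1) q ≤
      c * ((φ q.1 - φ q.2)^2 * ‖q.1 - q.2‖ ^ (-((d:ℝ) + ϑ)) * p q.2)
       + 2 / m * ((|φ q.1| * p q.1) * (|φ q.2| * p q.2)) := by
    rintro ⟨x, y⟩
    have hpx := hp0 x
    have hpy := hp0 y
    have hn : 0 ≤ ‖x - y‖ ^ (-((d:ℝ) + ϑ)) := by positivity
    by_cases hq : (x, y) ∈ S
    · rw [indicator_of_mem hq]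
      simp only
      have h1 : (φ x - φ y)^2 * p x
          ≤ c * ((φ x - φ y)^2 * ‖x - y‖ ^ (-((d:ℝ) + ϑ)) * p y) := by
        by_cases hxy : x = y
        · subst hxy; simp
        · have := mul_le_mul_of_nonneg_left (hSc x y hq hxy) (sq_nonneg (φ x - φ y))
          linarith
      have h2 : 2 * (|φ x| * p x * |φ y|) ≤ 2 / m * ((|φ x| * p x) * (|φ y| * p y)) := by
        rw [div_mul_eq_mul_div, le_div_iff₀ hm]
        have := mul_le_mul_of_nonneg_left (hSm x y hq)
          (show 0 ≤ 2 * (|φ x| * p x * |φ y|) by positivity)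
        linarith
      have h3 : φ x ^2 ≤ (φ x - φ y)^2 + 2 * (|φ x| * |φ y|) := by
        have := le_abs_self (φ x * φ y)
        rw [abs_mul] at this
        nlinarith [sq_nonneg (φ y)]
      have h4 := mul_le_mul_of_nonneg_right h3 hpx.le
      linarith
    · rw [indicator_of_notMem hq]
      positivity
  have i3 : Integrable (fun q : EuclideanSpace ℝ (Fin d) × EuclideanSpace ℝ (Fin d) =>
      c * ((φ q.1 - φ q.2)^2 * ‖q.1 - q.2‖ ^ (-((d:ℝ) + ϑ)) * p q.2)
       + 2 / m * ((|φ q.1| * p q.1) * (|φ q.2| * p q.2))) :=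
    (hfin.const_mul c).add (i2.const_mul (2/m))
  have m4 : AEStronglyMeasurable (fun q : EuclideanSpace ℝ (Fin d) × EuclideanSpace ℝ (Fin d) =>
      (φ q.1)^2 * p q.1) := by
    rw [Measure.volume_eq_prod]
    exact ((hφ.pow_const 2).aestronglyMeasurable.mul hp.1).comp_fst
  have i4 : Integrable (S.indicator (fun q => (φ q.1)^2 * p q.1)) := by
    refine i3.mono' (m4.indicator hS) (Eventually.of_forall fun q => ?_)
    rw [Real.norm_eq_abs, abs_of_nonneg]
    · exact hpt q
    · exact indicator_nonneg (fun q _ => mul_nonneg (sq_nonneg _) (hp0 _).le) q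
  have hmono := integral_mono i4 i3 hpt
  rw [integral_add (hfin.const_mul c) (i2.const_mul (2/m)), integral_const_mul, integral_const_mul,
    ← e2] at hmono
  refine le_trans (le_of_eq ?_) hmono
  rw [Measure.volume_eq_prod] at i4 ⊢
  rw [integral_prod _ i4, ← integral_const_mul, ← integral_indicator hA]
  congr 1; ext x
  have : ∀ y, S.indicator (fun q : EuclideanSpace ℝ (Fin d) × EuclideanSpace ℝ (Fin d) =>
      (φ q.1)^2 * p q.1) (x, y) = {y | (x,y) ∈ S}.indicator (fun _ => (φ x)^2 * p x) y := by
    intro y; rfl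
  simp_rw [this]
  rw [integral_indicator (show MeasurableSet {y | (x, y) ∈ S} from measurable_prodMk_left hS), setIntegral_const, hv x]
  by_cases hx : x ∈ A <;> simp [hx]

theorem hh_tail {d : ℕ} (p : EuclideanSpace ℝ (Fin d) → ℝ) (hp : Integrable p)
    (δ : ℝ) (hδ : 0 < δ) :
    ∃ R : ℝ, 0 < R ∧ ∫ x in (Metric.closedBall 0 R)ᶜ, p x < δ := by
  have h := tendsto_setIntegral_of_antitone (μ := volume) (f := p)
    (s := fun n : ℕ => (Metric.closedBall (0 : EuclideanSpace ℝ (Fin d)) (n:ℝ))ᶜ)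
    (fun n => Metric.isClosed_closedBall.measurableSet.compl)
    (fun a c hac => compl_subset_compl.2 (Metric.closedBall_subset_closedBall (by exact_mod_cast hac)))
    ⟨0, hp.integrableOn⟩
  have he : (⋂ n : ℕ, (Metric.closedBall (0 : EuclideanSpace ℝ (Fin d)) (n:ℝ))ᶜ) = ∅ := by
    rw [← compl_iUnion, Metric.iUnion_closedBall_nat, compl_univ]
  rw [he, Measure.restrict_empty, integral_zero_measure] at h
  obtain ⟨n, hn, hn1⟩ := ((h.eventually_lt_const hδ).and (eventually_ge_atTop 1)).exists
  exact ⟨n, by exact_mod_cast hn1, hn⟩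

theorem hh_weak {d : ℕ} (ϑ : ℝ) (hϑ : 0 < ϑ) (p : EuclideanSpace ℝ (Fin d) → ℝ)
    (hp : Integrable p) (hpc : Continuous p) (hp0 : ∀ x, 0 < p x) (hp1 : ∫ x, p x = 1)
    (r : ℝ) (hr : 0 < r) :
    ∃ a : ℝ, 0 < a ∧ ∀ φ : EuclideanSpace ℝ (Fin d) → ℝ, Measurable φ →
          (∃ Cb : ℝ, ∀ x, |φ x| ≤ Cb) → dirichletFinite d ϑ p φ →
          (∫ x, (φ x)^2 * p x) - (∫ x, φ x * p x)^2
            ≤ a * dirichletForm d ϑ p φ + r * (⨆ x, |φ x|)^2 := by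
  obtain ⟨R, hR, hRt⟩ := hh_tail p hp (r/4) (by positivity)
  obtain ⟨M, hM⟩ := (isCompact_closedBall (0 : EuclideanSpace ℝ (Fin d)) R).bddAbove_image
    hpc.continuousOn
  have hM' : ∀ x, ‖x‖ ≤ R → p x ≤ M := fun x hx =>
    hM ⟨x, by simpa using hx, rfl⟩
  have hM0 : 0 < M := (hp0 0).trans_le (hM' 0 (by simpa using hR.le))
  have hk : 0 < (d:ℝ) + ϑ := by positivity
  set c := M * (2*R)^((d:ℝ)+ϑ) with hcdef
  have hc0 : 0 < c := by positivity
  refine ⟨c/2, by positivity, ?_⟩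
  intro φ hφ ⟨Cb, hCb⟩ hfin
  set s := ⨆ x, |φ x| with hs
  have hsle : ∀ x, |φ x| ≤ s := fun x => le_ciSup (f := fun x => |φ x|) ⟨Cb, by rintro _ ⟨x, rfl⟩; exact hCb x⟩ x
  have hs0 : 0 ≤ s := (abs_nonneg _).trans (hsle 0)
  rw [hh_form ϑ p φ hfin]
  unfold dirichletFinite at hfin
  set T := (Metric.closedBall (0 : EuclideanSpace ℝ (Fin d)) R)ᶜ with hT
  have hTm : MeasurableSet T := Metric.isClosed_closedBall.measurableSet.compl
  have i1 : Integrable (fun x => φ x * p x) :=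
    hp.bdd_mul (c := s) hφ.aestronglyMeasurable
      (Eventually.of_forall fun x => by simpa using hsle x)
  have i2 : Integrable (fun x => (φ x)^2 * p x) :=
    hp.bdd_mul (c := s^2) (hφ.pow_const 2).aestronglyMeasurable
      (Eventually.of_forall fun x => by
        rw [norm_pow]; exact pow_le_pow_left₀ (norm_nonneg _) (hsle x) 2)
  have i3 : Integrable (T.indicator p) := hp.indicator hTm
  have iA : Integrable (fun q : EuclideanSpace ℝ (Fin d) × EuclideanSpace ℝ (Fin d) =>
    ((φ q.1)^2 * p q.1) * p q.2) := i2.mul_prod hp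
  have iB : Integrable (fun q : EuclideanSpace ℝ (Fin d) × EuclideanSpace ℝ (Fin d) =>
    p q.1 * ((φ q.2)^2 * p q.2)) := hp.mul_prod i2
  have iC : Integrable (fun q : EuclideanSpace ℝ (Fin d) × EuclideanSpace ℝ (Fin d) =>
    (φ q.1 * p q.1) * (φ q.2 * p q.2)) := i1.mul_prod i1
  have iD : Integrable (fun q : EuclideanSpace ℝ (Fin d) × EuclideanSpace ℝ (Fin d) =>
    T.indicator p q.1 * p q.2) := i3.mul_prod hp
  have iE : Integrable (fun q : EuclideanSpace ℝ (Fin d) × EuclideanSpace ℝ (Fin d) =>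
    p q.1 * T.indicator p q.2) := hp.mul_prod i3
  have hpt : ∀ q : EuclideanSpace ℝ (Fin d) × EuclideanSpace ℝ (Fin d),
      ((φ q.1)^2 * p q.1) * p q.2 + p q.1 * ((φ q.2)^2 * p q.2)
        - 2 * ((φ q.1 * p q.1) * (φ q.2 * p q.2)) ≤
      c * ((φ q.1 - φ q.2)^2 * ‖q.1 - q.2‖ ^ (-((d:ℝ) + ϑ)) * p q.2)
       + 4 * s^2 * (T.indicator p q.1 * p q.2 + p q.1 * T.indicator p q.2) := by
    rintro ⟨x, y⟩
    simp only
    have hpx := hp0 x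
    have hpy := hp0 y
    have hn : 0 ≤ ‖x - y‖ ^ (-((d:ℝ) + ϑ)) := by positivity
    have hix : 0 ≤ T.indicator p x := indicator_nonneg (fun q _ => (hp0 q).le) x
    have hiy : 0 ≤ T.indicator p y := indicator_nonneg (fun q _ => (hp0 q).le) y
    have e : ((φ x)^2 * p x) * p y + p x * ((φ y)^2 * p y)
        - 2 * ((φ x * p x) * (φ y * p y)) = (φ x - φ y)^2 * (p x * p y) := by ring
    rw [e]
    have hd4 : (φ x - φ y)^2 ≤ 4 * s^2 := by
      have : |φ x - φ y| ≤ 2 * s := (abs_sub _ _).trans (by linarith [hsle x, hsle y])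
      have := pow_le_pow_left₀ (abs_nonneg _) this 2
      rw [sq_abs] at this; linarith
    have hmul := mul_le_mul_of_nonneg_right hd4 (mul_pos hpx hpy).le
    by_cases hx : x ∈ T
    · have : 0 ≤ c * ((φ x - φ y)^2 * ‖x - y‖ ^ (-((d:ℝ) + ϑ)) * p y) := by positivity
      have h2 : 0 ≤ 4 * s^2 * (p x * T.indicator p y) := by positivity
      rw [indicator_of_mem hx]
      linarith
    by_cases hy : y ∈ T
    · have : 0 ≤ c * ((φ x - φ y)^2 * ‖x - y‖ ^ (-((d:ℝ) + ϑ)) * p y) := by positivity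
      have h2 : 0 ≤ 4 * s^2 * (T.indicator p x * p y) := by positivity
      rw [indicator_of_mem hy]
      linarith
    have h0 : 0 ≤ 4 * s^2 * (T.indicator p x * p y + p x * T.indicator p y) := by positivity
    refine le_trans ?_ (le_add_of_nonneg_right h0)
    by_cases hxy : x = y
    · subst hxy; simp
    have hx' : ‖x‖ ≤ R := by simpa [hT] using hx
    have hy' : ‖y‖ ≤ R := by simpa [hT] using hy
    have hnp : 0 < ‖x - y‖ := norm_pos_iff.2 (sub_ne_zero.2 hxy)
    have hle : ‖x - y‖ ≤ 2 * R := (norm_sub_le _ _).trans (by linarith)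
    have h1 : 1 ≤ (2*R)^((d:ℝ)+ϑ) * ‖x - y‖ ^ (-((d:ℝ) + ϑ)) := by
      rw [Real.rpow_neg hnp.le, ← div_eq_mul_inv, one_le_div (by positivity)]
      exact Real.rpow_le_rpow hnp.le hle hk.le
    have h2 : p x ≤ c * ‖x - y‖ ^ (-((d:ℝ) + ϑ)) := by
      rw [hcdef, mul_assoc]
      calc p x ≤ M * 1 := by linarith [hM' x hx']
        _ ≤ _ := mul_le_mul_of_nonneg_left h1 hM0.le
    have h3 := mul_le_mul_of_nonneg_left h2 (show 0 ≤ (φ x - φ y)^2 * p y by positivity)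
    linarith
  have hmono := integral_mono ((iA.add iB).sub (iC.const_mul 2))
    ((hfin.const_mul c).add ((iD.add iE).const_mul (4*s^2))) hpt
  simp only [Pi.add_apply, Pi.sub_apply] at hmono
  rw [integral_sub (by exact iA.add iB) (by exact iC.const_mul 2), integral_add iA iB, integral_const_mul,
    integral_add (by exact hfin.const_mul c) (by exact (iD.add iE).const_mul (4*s^2)), integral_const_mul,
    integral_const_mul, integral_add iD iE] at hmono
  have vA : ∫ q : EuclideanSpace ℝ (Fin d) × EuclideanSpace ℝ (Fin d),
    ((φ q.1)^2 * p q.1) * p q.2 = ∫ x, (φ x)^2 * p x := by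
    rw [Measure.volume_eq_prod, integral_prod_mul (fun x => (φ x)^2 * p x) p, hp1, mul_one]
  have vB : ∫ q : EuclideanSpace ℝ (Fin d) × EuclideanSpace ℝ (Fin d),
    p q.1 * ((φ q.2)^2 * p q.2) = ∫ x, (φ x)^2 * p x := by
    rw [Measure.volume_eq_prod, integral_prod_mul p (fun x => (φ x)^2 * p x), hp1, one_mul]
  have vC : ∫ q : EuclideanSpace ℝ (Fin d) × EuclideanSpace ℝ (Fin d),
    (φ q.1 * p q.1) * (φ q.2 * p q.2) = (∫ x, φ x * p x)^2 := by
    rw [Measure.volume_eq_prod, integral_prod_mul (fun x => φ x * p x) (fun x => φ x * p x), sq]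
  have vD : ∫ q : EuclideanSpace ℝ (Fin d) × EuclideanSpace ℝ (Fin d),
    T.indicator p q.1 * p q.2 = ∫ x in T, p x := by
    rw [Measure.volume_eq_prod, integral_prod_mul (T.indicator p) p, hp1, mul_one,
      integral_indicator hTm]
  have vE : ∫ q : EuclideanSpace ℝ (Fin d) × EuclideanSpace ℝ (Fin d),
    p q.1 * T.indicator p q.2 = ∫ x in T, p x := by
    rw [Measure.volume_eq_prod, integral_prod_mul p (T.indicator p), hp1, one_mul,
      integral_indicator hTm]
  rw [vA, vB, vC, vD, vE] at hmono
  have := mul_le_mul_of_nonneg_left hRt.le (show 0 ≤ 4 * s^2 by positivity)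
  linarith

theorem hh_super {d : ℕ} (hd : 0 < d) (ϑ : ℝ) (hϑ : 0 < ϑ) (p : EuclideanSpace ℝ (Fin d) → ℝ)
    (hp : Integrable p) (hpc : Continuous p) (hp0 : ∀ x, 0 < p x)
    (hdec : ∀ δ : ℝ, 0 < δ → ∃ R : ℝ, ∀ x, R < ‖x‖ → p x * ‖x‖ ^ ((d:ℝ) + ϑ) ≤ δ)
    (r : ℝ) (hr : 0 < r) :
    ∃ a : ℝ, 0 < a ∧ ∀ φ : EuclideanSpace ℝ (Fin d) → ℝ, Measurable φ →
          (∃ Cb : ℝ, ∀ x, |φ x| ≤ Cb) → dirichletFinite d ϑ p φ →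
          ∫ x, (φ x)^2 * p x ≤ r * dirichletForm d ϑ p φ + a * (∫ x, |φ x| * p x)^2 := by
  have : Nonempty (Fin d) := ⟨⟨0, hd⟩⟩
  have hk : 0 < (d:ℝ) + ϑ := by positivity
  set k := (d:ℝ) + ϑ with hkdef
  have hlow : ∀ R : ℝ, 0 ≤ R → ∃ m : ℝ, 0 < m ∧ ∀ x, ‖x‖ ≤ R → m ≤ p x := by
    intro R hR
    obtain ⟨x0, _, hx0⟩ := (isCompact_closedBall (0 : EuclideanSpace ℝ (Fin d)) R).exists_isMinOn
      ⟨0, by simpa using hR⟩ hpc.continuousOn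
    exact ⟨p x0, hp0 x0, fun x hx => hx0 (by simpa using hx)⟩
  obtain ⟨m1, hm1, hm1'⟩ := hlow 1 zero_le_one
  set V := volume.real (Metric.ball (0 : EuclideanSpace ℝ (Fin d)) 1) with hV
  have hV0 : 0 < V := ENNReal.toReal_pos (Metric.measure_ball_pos _ _ one_pos).ne'
    measure_ball_lt_top.ne
  -- tail radius
  obtain ⟨R0, hR0⟩ := hdec (r / 2 * V * m1 / 2 ^ k) (by positivity)
  set R := max R0 1 with hRdef
  have hR1 : 1 ≤ R := le_max_right _ _
  obtain ⟨m, hm, hm'⟩ := hlow (R+1) (by linarith)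
  obtain ⟨M, hM⟩ := (isCompact_closedBall (0 : EuclideanSpace ℝ (Fin d)) R).bddAbove_image
    hpc.continuousOn
  have hM' : ∀ x, ‖x‖ ≤ R → p x ≤ M := fun x hx => hM ⟨x, by simpa using hx, rfl⟩
  have hM0 : 0 < M := (hp0 0).trans_le (hM' 0 (by simp; linarith))
  -- choose h
  obtain ⟨h, hh0, hh1, hh⟩ : ∃ h : ℝ, 0 < h ∧ h ≤ 1 ∧ M / m * h ^ ϑ ≤ r / 2 * V := by
    have hcont : Tendsto (fun h : ℝ => M / m * h ^ ϑ) (𝓝[>] 0) (𝓝 (M / m * 0 ^ ϑ)) :=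
      (((Real.continuousAt_rpow_const 0 ϑ (Or.inr hϑ.le)).tendsto).mono_left
        nhdsWithin_le_nhds).const_mul _
    rw [Real.zero_rpow hϑ.ne', mul_zero] at hcont
    have h1 := hcont.eventually_le_const (show 0 < r / 2 * V by positivity)
    obtain ⟨h, h2, h3⟩ := (h1.and (Ioc_mem_nhdsGT one_pos)).exists
    exact ⟨h, h3.1, h3.2, h2⟩
  have hVh : ∀ x : EuclideanSpace ℝ (Fin d), volume.real (Metric.ball x h) = h ^ d * V := by
    intro x
    rw [hV, measureReal_def, Measure.addHaar_ball _ _ hh0.le, ENNReal.toReal_mul,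
      ENNReal.toReal_ofReal (by positivity), measureReal_def]
    simp
  set v := h ^ d * V with hv
  have hv0 : 0 < v := by positivity
  refine ⟨2 / m / v + 2 / m1 / V, by positivity, ?_⟩
  intro φ hφ hbd hfin
  set B := Metric.closedBall (0 : EuclideanSpace ℝ (Fin d)) R with hB
  have hBm : MeasurableSet B := Metric.isClosed_closedBall.measurableSet
  have c1 := hh_core ϑ p φ hp hp0 hφ hbd hfin B hBm
    {q | q.1 ∈ B ∧ dist q.2 q.1 < h}
    ((measurable_fst hBm).inter
      (isOpen_lt (continuous_snd.dist continuous_fst) continuous_const).measurableSet)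
    v (M / m * h ^ k) m hm (by positivity)
    (by
      intro x
      by_cases hx : x ∈ B
      · rw [indicator_of_mem hx, ← hVh x]
        congr 1; ext y; simp [hx]
      · simp [hx])
    (by
      intro x
      refine ne_top_of_le_ne_top (measure_ball_lt_top (μ := volume) (x := x) (r := h)).ne
        (measure_mono fun y hy => hy.2))
    (by
      rintro x y ⟨hx, hy⟩ hxy
      simp only at hx hy
      have hx' : ‖x‖ ≤ R := by simpa [hB] using hx
      have hnp : 0 < ‖x - y‖ := norm_pos_iff.2 (sub_ne_zero.2 hxy)
      have hle : ‖x - y‖ ≤ h := by rw [← dist_eq_norm, dist_comm]; exact hy.le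
      have hyn : ‖y‖ ≤ R + 1 := by
        have : ‖y‖ ≤ ‖x‖ + ‖x - y‖ := by
          have := norm_sub_le x (x - y); simpa using this
        linarith
      have h1 : 1 ≤ h ^ k * ‖x - y‖ ^ (-k) := by
        rw [Real.rpow_neg hnp.le, ← div_eq_mul_inv, one_le_div (by positivity)]
        exact Real.rpow_le_rpow hnp.le hle hk.le
      have h2 : 1 ≤ p y / m := (one_le_div hm).2 (hm' y hyn)
      calc p x ≤ M * (1 * 1) := by linarith [hM' x hx']
        _ ≤ M * ((h ^ k * ‖x - y‖ ^ (-k)) * (p y / m)) := by gcongr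
        _ = _ := by ring)
    (by
      rintro x y ⟨hx, hy⟩
      simp only at hx hy
      have hx' : ‖x‖ ≤ R := by simpa [hB] using hx
      apply hm'
      have : ‖y‖ ≤ ‖x‖ + ‖y - x‖ := by
        have := norm_add_le x (y - x); simpa using this
      rw [dist_eq_norm] at hy
      linarith)
  have c2 := hh_core ϑ p φ hp hp0 hφ hbd hfin Bᶜ hBm.compl
    (Bᶜ ×ˢ Metric.ball 0 1) (hBm.compl.prod Metric.isOpen_ball.measurableSet)
    V (r / 2 * V) m1 hm1 (by positivity)
    (by
      intro x
      by_cases hx : x ∈ B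
      · simp [hx]
      · rw [indicator_of_mem (show x ∈ Bᶜ from hx), hV]
        congr 1; ext y; simp [hx])
    (by
      intro x
      refine ne_top_of_le_ne_top (measure_ball_lt_top (μ := volume)
        (x := (0 : EuclideanSpace ℝ (Fin d))) (r := 1)).ne (measure_mono fun y hy => hy.2))
    (by
      rintro x y ⟨hx, hy⟩ hxy
      simp only at hx hy
      have hx' : R < ‖x‖ := by simpa [hB] using hx
      have hy' : ‖y‖ < 1 := by simpa using hy
      have hnp : 0 < ‖x - y‖ := norm_pos_iff.2 (sub_ne_zero.2 hxy)
      have hle : ‖x - y‖ ≤ 2 * ‖x‖ := (norm_sub_le _ _).trans (by linarith)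
      have h1 := hR0 x (lt_of_le_of_lt (le_max_left _ _) hx')
      have hpx := hp0 x
      rw [le_div_iff₀ (by positivity)] at h1
      have h2 : ‖x - y‖ ^ k ≤ 2 ^ k * ‖x‖ ^ k := by
        rw [← Real.mul_rpow (by norm_num) (norm_nonneg _)]
        exact Real.rpow_le_rpow hnp.le hle hk.le
      have h3 := hm1' y hy'.le
      rw [Real.rpow_neg hnp.le, ← div_eq_inv_mul, ← mul_div_assoc, le_div_iff₀ (by positivity)]
      calc p x * ‖x - y‖ ^ k ≤ p x * (2 ^ k * ‖x‖ ^ k) := by gcongr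
        _ ≤ r / 2 * V * m1 := by linarith
        _ ≤ r / 2 * V * p y := by gcongr)
    (by
      rintro x y ⟨hx, hy⟩
      apply hm1'
      have hy' : ‖y‖ < 1 := by simpa using hy
      exact hy'.le)
  have i2 : Integrable (fun x => (φ x)^2 * p x) := by
    obtain ⟨s, hs⟩ := hbd
    exact hp.bdd_mul (c := s^2) (hφ.pow_const 2).aestronglyMeasurable
      (Eventually.of_forall fun x => by
        rw [norm_pow]; exact pow_le_pow_left₀ (norm_nonneg _) (hs x) 2)
  have hE : 0 ≤ dirichletForm d ϑ p φ := by
    unfold dirichletForm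
    refine integral_nonneg fun y => mul_nonneg (integral_nonneg fun x => ?_) (hp0 y).le
    positivity
  rw [← integral_add_compl hBm i2]
  set E := dirichletForm d ϑ p φ
  set J := (∫ x, |φ x| * p x)^2
  have hcoef : M / m * h ^ k ≤ r / 2 * v := by
    have : h ^ k = h ^ d * h ^ ϑ := by
      rw [hkdef, Real.rpow_add hh0, Real.rpow_natCast]
    rw [this, hv]
    have := mul_le_mul_of_nonneg_left hh (show 0 ≤ h ^ d by positivity)
    linarith
  have b1 : ∫ x in B, (φ x)^2 * p x ≤ r / 2 * E + 2 / m / v * J := by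
    have h1 : v * ∫ x in B, (φ x)^2 * p x ≤ v * (r / 2 * E + 2 / m / v * J) := by
      have e : v * (r / 2 * E + 2 / m / v * J) = r / 2 * v * E + 2 / m * J := by field_simp
      rw [e]
      have := mul_le_mul_of_nonneg_right hcoef hE
      linarith
    exact le_of_mul_le_mul_left h1 hv0
  have b2 : ∫ x in Bᶜ, (φ x)^2 * p x ≤ r / 2 * E + 2 / m1 / V * J := by
    have h1 : V * ∫ x in Bᶜ, (φ x)^2 * p x ≤ V * (r / 2 * E + 2 / m1 / V * J) := by
      have e : V * (r / 2 * E + 2 / m1 / V * J) = r / 2 * V * E + 2 / m1 * J := by field_simp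
      rw [e]
      exact c2
    exact le_of_mul_le_mul_left h1 hV0
  linarith


/-- Proposition 5.3 of the paper: under Assumptions A0 and A2
(degenerate convexity), with `π ∝ e^{−f}` and the nonlocal Dirichlet form `E`:
(1) if `θ < 2 − β`, or `θ = 2 − β` and `ϑ < μ β⁻¹ b⁻¹`, then `π` satisfies a super
Poincaré inequality `∫φ²dπ ≤ r E(φ) + β̃(r)(∫|φ|dπ)²`;
(2) if `θ = 2 − β` and `ϑ ≥ μ β⁻¹ b⁻¹`, or `θ > 2 − β`, then `π` satisfies a weak
Poincaré inequality `Var_π(φ) ≤ α̃(r) E(φ) + r ‖φ‖_∞²`. -/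
theorem superPoincare_or_weakPoincare_from_degenerate_convexity
    (d : ℕ) (hd : 0 < d) (b β ϑ : ℝ) (hb : 0 < b) (hβ : β ∈ Ioc (1:ℝ) 2)
    (hϑ : ϑ ∈ Ioo (0:ℝ) 2)
    (f : EuclideanSpace ℝ (Fin d) → ℝ) (f0 : ℝ → ℝ)
    (hiso : ∀ x : EuclideanSpace ℝ (Fin d), f x = f0 ‖x‖)
    (hf0 : ContDiff ℝ 2 f0)
    (hint : Integrable (fun x : EuclideanSpace ℝ (Fin d) => Real.exp (-(f x))))
    (μ θ N2 : ℝ) (hμ : 0 < μ) (hθ : 0 ≤ θ) (hN2 : 0 < N2)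
    (hA2 : ∀ r : ℝ, N2 < r →
      μ / (1 + r^2 / 4) ^ (θ / 2) <
        deriv f0 (Real.exp (b * r ^ β)) * deriv (fun s => Real.exp (b * s ^ β)) r / r
          - b * β * d * r ^ (β - 2) + ((d:ℝ) - β) * r ^ (-2 : ℝ) ∧
      μ / (1 + r^2 / 4) ^ (θ / 2) <
        deriv (deriv f0) (Real.exp (b * r ^ β)) * (deriv (fun s => Real.exp (b * s ^ β)) r)^2
          + deriv f0 (Real.exp (b * r ^ β)) * deriv (deriv (fun s => Real.exp (b * s ^ β))) r
          - b * β * (β - 1) * d * r ^ (β - 2) - ((d:ℝ) - β) * r ^ (-2 : ℝ)) :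
    ((θ < 2 - β ∨ (θ = 2 - β ∧ ϑ < μ / (β * b))) →
      ∃ βt : ℝ → ℝ, (∀ r : ℝ, 0 < r → 0 < βt r) ∧
        ∀ r : ℝ, 0 < r →
        ∀ φ : EuclideanSpace ℝ (Fin d) → ℝ, Measurable φ →
          (∃ Cb : ℝ, ∀ x, |φ x| ≤ Cb) →
          dirichletFinite d ϑ (targetDensity d f) φ →
          ∫ x, (φ x)^2 * targetDensity d f x
            ≤ r * dirichletForm d ϑ (targetDensity d f) φ
              + βt r * (∫ x, |φ x| * targetDensity d f x)^2) ∧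
    (((θ = 2 - β ∧ μ / (β * b) ≤ ϑ) ∨ 2 - β < θ) →
      ∃ αt : ℝ → ℝ, (∀ r : ℝ, 0 < r → 0 < αt r) ∧
        ∀ r : ℝ, 0 < r →
        ∀ φ : EuclideanSpace ℝ (Fin d) → ℝ, Measurable φ →
          (∃ Cb : ℝ, ∀ x, |φ x| ≤ Cb) →
          dirichletFinite d ϑ (targetDensity d f) φ →
          (∫ x, (φ x)^2 * targetDensity d f x)
              - (∫ x, φ x * targetDensity d f x)^2
            ≤ αt r * dirichletForm d ϑ (targetDensity d f) φ
              + r * (⨆ x, |φ x|)^2) := by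
  have hfc : Continuous f := by
    have : f = fun x => f0 ‖x‖ := funext hiso
    rw [this]; exact hf0.continuous.comp continuous_norm
  have hZ : 0 < ∫ z, Real.exp (-(f z)) := integral_exp_pos hint
  have hp : Integrable (targetDensity d f) := hint.div_const _
  have hpc : Continuous (targetDensity d f) := by
    unfold targetDensity
    exact (Real.continuous_exp.comp hfc.neg).div_const _
  have hp0 : ∀ x, 0 < targetDensity d f x := fun x => div_pos (Real.exp_pos _) hZ
  have hp1 : ∫ x, targetDensity d f x = 1 := by
    unfold targetDensity
    rw [integral_div, div_self hZ.ne']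
  constructor
  · intro hc
    obtain ⟨ε, hε, ρ0, hρ0, hg⟩ := hh_growth (d:ℝ) b β ϑ hb hβ f0 μ θ N2 hμ hθ
      (fun r hr => (hA2 r hr).1) hc
    have hdecay := hh_decay f0 hf0 ((d:ℝ) + ϑ) ε ρ0 hε hρ0 hg
    have hdec : ∀ δ : ℝ, 0 < δ → ∃ R : ℝ, ∀ x, R < ‖x‖ →
        targetDensity d f x * ‖x‖ ^ ((d:ℝ) + ϑ) ≤ δ := by
      intro δ hδ
      obtain ⟨R, hR⟩ := eventually_atTop.1
        (hdecay.eventually_le_const (mul_pos hδ hZ))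
      refine ⟨R, fun x hx => ?_⟩
      have := hR ‖x‖ hx.le
      unfold targetDensity
      rw [div_mul_eq_mul_div, div_le_iff₀ hZ]
      simpa only [hiso] using this
    choose! a ha using fun r hr => hh_super hd ϑ hϑ.1 (targetDensity d f) hp hpc hp0 hdec r hr
    exact ⟨a, fun r hr => (ha r hr).1, fun r hr => (ha r hr).2⟩
  · intro _
    choose! a ha using fun r hr => hh_weak ϑ hϑ.1 (targetDensity d f) hp hpc hp0 hp1 r hr
    exact ⟨a, fun r hr => (ha r hr).1, fun r hr => (ha r hr).2⟩
end
end

section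
/- Let b > 0, β ∈ (1,2], ϑ ∈ (0,2), and let f satisfy Assumptions A0 and A3 (strong convexity at infinity) with parameter ρ > 0. Let π(x) = Z^{-1} e^{-f(x)} and define the nonlocal Dirichlet form E(φ) = ∬_{x ≠ y} (φ(x) − φ(y))² |x − y|^{−(d+ϑ)} dx π(y)dy. Then: (1) if β ∈ (1,2), or β = 2 and ϑ < ρ b^{-1}/2, then π satisfies the super Poincaré inequality: there exists β̃ : (0,∞) → (0,∞) such that for every r > 0 and bounded measurable φ with E(φ) < ∞, ∫ φ² dπ ≤ r E(φ) + β̃(r) (∫|φ| dπ)²; (2) if β = 2, ϑ = ρ b^{-1}/2 and d ∈ {1,2}, then π satisfies the Poincaré inequality: there is C > 0 with Var_π(φ) ≤ C E(φ) for all φ in the Dirichlet domain; (3) if β = 2 and either (ϑ = ρ b^{-1}/2 with d ≥ 3) or ϑ > ρ b^{-1}/2, then π satisfies the weak Poincaré inequality: there exists α̃ : (0,∞) → (0,∞) such that for every r > 0 and bounded measurable φ with E(φ) < ∞, Var_π(φ) ≤ α̃(r) E(φ) + r ‖φ‖_∞². -/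
open Filter MeasureTheory Set
open scoped RealInnerProductSpace Topology

noncomputable section
/-- Integrated form of the first inequality of A3. -/
lemma tail_lower (d : ℕ) (b β : ℝ)
    (f0 : ℝ → ℝ) (hf0 : ContDiff ℝ 2 f0) (N3 ρ : ℝ) (hN3 : 0 < N3)
    (hA : ∀ r : ℝ, N3 < r →
      ρ < deriv f0 (Real.exp (b * r ^ β)) * deriv (fun s => Real.exp (b * s ^ β)) r / r
            - b * β * d * r ^ (β - 2) + ((d:ℝ) - β) * r ^ (-2 : ℝ)) :
    ∃ c : ℝ, ∀ r : ℝ, N3 + 1 ≤ r →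
      c + ρ * r^2 / 2 + b * d * r ^ β - (d - β) * Real.log r ≤ f0 (Real.exp (b * r ^ β)) := by
  set G : ℝ → ℝ := fun r => f0 (Real.exp (b * r ^ β)) - ρ * r^2 / 2 - b * d * r ^ β
    + (d - β) * Real.log r with hG
  have hpow : ∀ r : ℝ, 0 < r → HasDerivAt (fun s : ℝ => s ^ β) (β * r ^ (β - 1)) r :=
    fun r hr => Real.hasDerivAt_rpow_const (Or.inl hr.ne')
  have hexp : ∀ r : ℝ, 0 < r → HasDerivAt (fun s : ℝ => Real.exp (b * s ^ β))
      (Real.exp (b * r ^ β) * (b * (β * r ^ (β - 1)))) r :=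
    fun r hr => ((hpow r hr).const_mul b).exp
  have hder : ∀ r : ℝ, 0 < r → HasDerivAt G
      (deriv f0 (Real.exp (b * r ^ β)) * deriv (fun s => Real.exp (b * s ^ β)) r
        - ρ * r - b * d * (β * r ^ (β - 1)) + (d - β) * r⁻¹) r := by
    intro r hr
    have h1 : HasDerivAt f0 (deriv f0 (Real.exp (b * r ^ β))) (Real.exp (b * r ^ β)) :=
      ((hf0.differentiable (by norm_num)) _).hasDerivAt
    have h2 := h1.comp r (hexp r hr)
    rw [← (hexp r hr).deriv] at h2
    have h3 : HasDerivAt (fun r : ℝ => ρ * r^2 / 2) (ρ * r) r := by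
      refine (((hasDerivAt_pow 2 r).const_mul ρ).div_const 2).congr_deriv ?_
      push_cast
      ring
    exact ((h2.sub h3).sub ((hpow r hr).const_mul (b * d))).add
      ((Real.hasDerivAt_log hr.ne').const_mul _)
  have mono : MonotoneOn G (Ici (N3 + 1)) := by
    refine monotoneOn_of_deriv_nonneg (convex_Ici _) ?_ ?_ ?_
    · intro r hr
      have : N3 + 1 ≤ r := hr
      exact (hder r (by linarith)).continuousAt.continuousWithinAt
    · intro r hr
      rw [interior_Ici] at hr
      have : N3 + 1 < r := hr
      exact (hder r (by linarith)).differentiableAt.differentiableWithinAt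
    · intro r hr
      rw [interior_Ici] at hr
      have hr' : N3 + 1 < r := hr
      have r0 : 0 < r := by linarith
      rw [(hder r r0).deriv]
      have h := hA r (by linarith)
      set D := deriv f0 (Real.exp (b * r ^ β)) * deriv (fun s => Real.exp (b * s ^ β)) r
      have e1 : r ^ (β - 2) * r = r ^ (β - 1) := by
        rw [← Real.rpow_add_one r0.ne']; congr 1; ring
      have e2 : r ^ (-2 : ℝ) * r = r⁻¹ := by
        rw [← Real.rpow_add_one r0.ne', ← Real.rpow_neg_one]; congr 1; norm_num
      have h' := mul_lt_mul_of_pos_right h r0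
      have e3 : (D / r - b * β * d * r ^ (β - 2) + ((d:ℝ) - β) * r ^ (-2 : ℝ)) * r
          = D - b * β * d * (r ^ (β - 2) * r) + (d - β) * (r ^ (-2 : ℝ) * r) := by
        field_simp
      rw [e3, e1, e2] at h'
      nlinarith
  refine ⟨G (N3 + 1), fun r hr => ?_⟩
  have := mono (self_mem_Ici) (show r ∈ Ici (N3 + 1) from hr) hr
  have e : G r = f0 (Real.exp (b * r ^ β)) - ρ * r^2 / 2 - b * d * r ^ β
    + (d - β) * Real.log r := rfl
  linarith

/-- every large radius is `exp (b r^β)` -/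
lemma radius_param (b β : ℝ) (hb : 0 < b) (hβ : 0 < β) (T : ℝ) (hT : 0 ≤ T) (R : ℝ)
    (hR : Real.exp (b * T ^ β) ≤ R) : ∃ r, T ≤ r ∧ R = Real.exp (b * r ^ β) := by
  have hR0 : 0 < R := (Real.exp_pos _).trans_le hR
  have h1 : b * T ^ β ≤ Real.log R := (Real.le_log_iff_exp_le hR0).2 hR
  have h2 : T ^ β ≤ Real.log R / b := by rw [le_div_iff₀ hb]; linarith
  have h3 : 0 ≤ Real.log R / b := (Real.rpow_nonneg hT _).trans h2
  refine ⟨(Real.log R / b) ^ β⁻¹, ?_, ?_⟩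
  · calc T = (T ^ β) ^ β⁻¹ := by rw [← Real.rpow_mul hT, mul_inv_cancel₀ hβ.ne', Real.rpow_one]
      _ ≤ _ := Real.rpow_le_rpow (Real.rpow_nonneg hT _) h2 (by positivity)
  · rw [← Real.rpow_mul h3, inv_mul_cancel₀ hβ.ne', Real.rpow_one, mul_div_cancel₀ _ hb.ne',
      Real.exp_log hR0]

lemma tail_exp_bound (d : ℕ) (b β ϑ c ρ r F : ℝ)
    (h : c + ρ * r^2 / 2 + b * d * r ^ β - (d - β) * Real.log r ≤ F) :
    (Real.exp (b * r ^ β)) ^ ((d:ℝ) + ϑ) * Real.exp (-F) ≤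
      Real.exp (b * ϑ * r ^ β - ρ * r^2 / 2 + (d - β) * Real.log r - c) := by
  rw [← Real.exp_mul, ← Real.exp_add, Real.exp_le_exp]
  nlinarith

lemma exponent_tendsto (b β ϑ ρ k c : ℝ) (hρ : 0 < ρ) (hb : 0 < b)
    (h : β < 2 ∨ (β = 2 ∧ ϑ < ρ / b / 2)) :
    Tendsto (fun r : ℝ => b * ϑ * r ^ β - ρ * r^2 / 2 + k * Real.log r - c) atTop atBot := by
  have hlog : Real.log =o[atTop] fun r : ℝ => r ^ (2:ℝ) := isLittleO_log_rpow_atTop (by norm_num)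
  have hsq : Tendsto (fun r : ℝ => r ^ (2:ℝ)) atTop atTop := tendsto_rpow_atTop (by norm_num)
  have l1 : Tendsto (fun r : ℝ => Real.log r / r ^ (2:ℝ)) atTop (𝓝 0) := hlog.tendsto_div_nhds_zero
  have l2 : Tendsto (fun r : ℝ => c / r ^ (2:ℝ)) atTop (𝓝 0) := hsq.const_div_atTop c
  have l3 : ∃ L, L < ρ / 2 ∧ Tendsto (fun r : ℝ => b * ϑ * (r ^ β / r ^ (2:ℝ))) atTop (𝓝 L) := by
    rcases h with h | ⟨h, h'⟩
    · refine ⟨b * ϑ * 0, by simpa using hρ, Tendsto.const_mul _ ?_⟩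
      have := tendsto_rpow_neg_atTop (y := 2 - β) (by linarith)
      refine this.congr' ?_
      filter_upwards [eventually_gt_atTop 0] with r hr
      rw [← Real.rpow_sub hr]; congr 1; ring
    · refine ⟨b * ϑ * 1, ?_, Tendsto.const_mul _ ?_⟩
      · rw [div_div, lt_div_iff₀ (by positivity)] at h'
        linarith
      · refine tendsto_const_nhds.congr' ?_
        filter_upwards [eventually_gt_atTop 0] with r hr
        rw [h, div_self (by positivity)]
  obtain ⟨L, hL, l3⟩ := l3
  have hl := ((l3.sub_const (ρ / 2)).add (l1.const_mul k)).sub l2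
  have := hsq.atTop_mul_neg (C := L - ρ / 2 + k * 0 - 0) (by linarith) hl
  refine this.congr' ?_
  filter_upwards [eventually_gt_atTop 0] with r hr
  have e : r ^ (2:ℝ) = r ^ 2 := by norm_cast
  rw [e]
  field_simp

section Helpers

variable {d : ℕ}

/-- The nonlocal kernel. -/
def nlKernel (s : ℝ) (φ : EuclideanSpace ℝ (Fin d) → ℝ)
    (p : EuclideanSpace ℝ (Fin d) × EuclideanSpace ℝ (Fin d)) : ℝ :=
  (φ p.1 - φ p.2)^2 * ‖p.1 - p.2‖ ^ (-s)

lemma nlKernel_nonneg (s : ℝ) (φ : EuclideanSpace ℝ (Fin d) → ℝ) (p) : 0 ≤ nlKernel s φ p := by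
  unfold nlKernel; positivity

lemma nlKernel_swap (s : ℝ) (φ : EuclideanSpace ℝ (Fin d) → ℝ) (p) :
    nlKernel s φ p.swap = nlKernel s φ p := by
  unfold nlKernel
  rw [Prod.fst_swap, Prod.snd_swap, norm_sub_rev]; ring

lemma nlKernel_mul (s : ℝ) (φ : EuclideanSpace ℝ (Fin d) → ℝ) (p) :
    (φ p.1 - φ p.2)^2 = nlKernel s φ p * ‖p.1 - p.2‖ ^ s := by
  unfold nlKernel
  by_cases h : p.1 = p.2
  · simp [h]
  · have : 0 < ‖p.1 - p.2‖ := norm_pos_iff.2 (sub_ne_zero.2 h)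
    rw [mul_assoc, ← Real.rpow_add this]; simp

lemma energy_facts (ϑ : ℝ) (π φ : EuclideanSpace ℝ (Fin d) → ℝ)
    (hE : dirichletFinite d ϑ π φ) :
    Integrable (fun p => nlKernel (d + ϑ) φ p * π p.2) ∧
    Integrable (fun p => nlKernel (d + ϑ) φ p * π p.1) ∧
    ∫ p, nlKernel (d + ϑ) φ p * π p.2 = dirichletForm d ϑ π φ ∧
    ∫ p, nlKernel (d + ϑ) φ p * π p.1 = dirichletForm d ϑ π φ := by
  have h1 : Integrable (fun p => nlKernel (d + ϑ) φ p * π p.2) := hE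
  have e1 : ∫ p, nlKernel (d + ϑ) φ p * π p.2 = dirichletForm d ϑ π φ := by
    rw [Measure.volume_eq_prod] at h1 ⊢
    rw [integral_prod_symm _ h1]
    unfold dirichletForm nlKernel
    simp_rw [integral_mul_const]
  have sw : (fun p : EuclideanSpace ℝ (Fin d) × EuclideanSpace ℝ (Fin d) =>
      nlKernel (d + ϑ) φ p * π p.1) = fun p => (fun p => nlKernel (d + ϑ) φ p * π p.2) p.swap := by
    funext p
    simp [nlKernel_swap]
  refine ⟨h1, ?_, e1, ?_⟩
  · rw [sw]
    rw [Measure.volume_eq_prod] at h1 ⊢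
    exact h1.swap
  · rw [sw, ← e1, Measure.volume_eq_prod]
    exact integral_prod_swap (fun p => nlKernel (d + ϑ) φ p * π p.2)

lemma dirichletForm_nonneg (ϑ : ℝ) (π φ : EuclideanSpace ℝ (Fin d) → ℝ) (hπ : ∀ x, 0 < π x) :
    0 ≤ dirichletForm d ϑ π φ := by
  unfold dirichletForm
  refine integral_nonneg fun y => mul_nonneg (integral_nonneg fun x => ?_) (hπ y).le
  positivity

lemma integrable_bdd (π g : EuclideanSpace ℝ (Fin d) → ℝ) (hπi : Integrable π)
    (hg : Measurable g) (C : ℝ) (hC : ∀ x, |g x| ≤ C) : Integrable (fun x => g x * π x) :=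
  hπi.bdd_mul (c := C) hg.aestronglyMeasurable (Eventually.of_forall hC)

/-- Variance bound from a pointwise bound. -/
lemma var_bound (ϑ : ℝ) (π φ t : EuclideanSpace ℝ (Fin d) → ℝ)
    (hπi : Integrable π) (hπ1 : ∫ x, π x = 1)
    (hφ : Measurable φ) (Cb : ℝ) (hCb : ∀ x, |φ x| ≤ Cb)
    (hE : dirichletFinite d ϑ π φ) (C : ℝ) (hti : Integrable t)
    (hp : ∀ x y, (φ x - φ y)^2 * (π x * π y) ≤
      C * (nlKernel (d + ϑ) φ (x, y) * (π x + π y)) + (t x * π y + π x * t y)) :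
    (∫ x, (φ x)^2 * π x) - (∫ x, φ x * π x)^2 ≤
      C * dirichletForm d ϑ π φ + ∫ x, t x := by
  obtain ⟨i2, i1, e2, e1⟩ := energy_facts ϑ π φ hE
  have j1 : Integrable (fun x => φ x * π x) := integrable_bdd π φ hπi hφ Cb hCb
  have j2 : Integrable (fun x => (φ x)^2 * π x) :=
    integrable_bdd π (fun x => φ x ^ 2) hπi (hφ.pow_const 2) (Cb^2) (fun x => by
      rw [abs_pow]; exact pow_le_pow_left₀ (abs_nonneg _) (hCb x) 2)
  have a1 := j2.mul_prod hπi
  have a2 := hπi.mul_prod j2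
  have a3 := j1.mul_prod j1
  have b1 := hti.mul_prod hπi
  have b2 := hπi.mul_prod hti
  rw [Measure.volume_eq_prod] at i1 i2 e1 e2
  have key : ∫ p, (((φ p.1)^2 * π p.1 * π p.2 + π p.1 * ((φ p.2)^2 * π p.2))
      - 2 * (φ p.1 * π p.1 * (φ p.2 * π p.2))) ∂((volume : Measure (EuclideanSpace ℝ (Fin d))).prod
        (volume : Measure (EuclideanSpace ℝ (Fin d)))) ≤
      ∫ p, (C * (nlKernel (d + ϑ) φ p * π p.1 + nlKernel (d + ϑ) φ p * π p.2) +
        (t p.1 * π p.2 + π p.1 * t p.2)) ∂((volume : Measure (EuclideanSpace ℝ (Fin d))).prod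
        (volume : Measure (EuclideanSpace ℝ (Fin d)))) := by
    refine integral_mono ((a1.add a2).sub (a3.const_mul 2))
      (((i1.add i2).const_mul C).add (b1.add b2)) fun p => ?_
    have := hp p.1 p.2
    simp only
    simp only [Prod.mk.eta] at this
    linarith
  rw [integral_sub (a1.fun_add a2) (a3.const_mul 2),
    integral_add ((i1.fun_add i2).const_mul C) (b1.fun_add b2), integral_const_mul, integral_const_mul,
    integral_add i1 i2, e1, e2, integral_add b1 b2, integral_add a1 a2,
    integral_prod_mul (fun x => φ x ^ 2 * π x) π, integral_prod_mul π (fun x => φ x ^ 2 * π x),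
    integral_prod_mul (fun x => φ x * π x) (fun x => φ x * π x),
    integral_prod_mul t π, integral_prod_mul π t, hπ1] at key
  nlinarith

lemma poincare_of_tail (ϑ : ℝ) (hϑ : 0 < ϑ) (π : EuclideanSpace ℝ (Fin d) → ℝ)
    (hπ0 : ∀ x, 0 < π x) (hπi : Integrable π) (hπ1 : ∫ x, π x = 1)
    (M : ℝ) (hM : ∀ x, ‖x‖ ^ ((d:ℝ) + ϑ) * π x ≤ M) :
    ∃ C : ℝ, 0 < C ∧
        ∀ φ : EuclideanSpace ℝ (Fin d) → ℝ, Measurable φ →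
          (∃ Cb : ℝ, ∀ x, |φ x| ≤ Cb) →
          dirichletFinite d ϑ π φ →
          (∫ x, (φ x)^2 * π x) - (∫ x, φ x * π x)^2 ≤ C * dirichletForm d ϑ π φ := by
  have hs : 0 < (d:ℝ) + ϑ := by positivity
  have hM0 : 0 ≤ M := le_trans (mul_nonneg (by positivity) (hπ0 0).le) (hM 0)
  have hC0 : 0 ≤ 2 ^ ((d:ℝ) + ϑ) * M := by positivity
  refine ⟨2 ^ ((d:ℝ) + ϑ) * M + 1, by positivity, fun φ hφ ⟨Cb, hCb⟩ hE => ?_⟩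
  have := var_bound ϑ π φ (fun _ => 0) hπi hπ1 hφ Cb hCb hE (2 ^ ((d:ℝ) + ϑ) * M)
    (integrable_zero _ _ _) ?_
  · have h0 := dirichletForm_nonneg ϑ π φ hπ0
    simp only [integral_zero] at this
    linarith
  · intro x y
    have hK := nlKernel_nonneg (d + ϑ) φ (x, y)
    have e := nlKernel_mul (d + ϑ) φ (x, y)
    simp only at e
    have px := hπ0 x
    have py := hπ0 y
    simp only [zero_mul, mul_zero, add_zero]
    rw [e]
    have main : ‖x - y‖ ^ ((d:ℝ) + ϑ) * (π x * π y) ≤ 2 ^ ((d:ℝ) + ϑ) * M * (π x + π y) := by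
      have tri : ∀ u v : EuclideanSpace ℝ (Fin d), ‖u‖ ≤ ‖v‖ →
          ‖u - v‖ ^ ((d:ℝ) + ϑ) * π v ≤ 2 ^ ((d:ℝ) + ϑ) * M := by
        intro u v huv
        have h1 : ‖u - v‖ ≤ 2 * ‖v‖ := (norm_sub_le u v).trans (by linarith)
        have h2 : ‖u - v‖ ^ ((d:ℝ) + ϑ) ≤ 2 ^ ((d:ℝ) + ϑ) * ‖v‖ ^ ((d:ℝ) + ϑ) := by
          rw [← Real.mul_rpow (by norm_num) (norm_nonneg _)]
          exact Real.rpow_le_rpow (norm_nonneg _) h1 hs.le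
        calc _ ≤ 2 ^ ((d:ℝ) + ϑ) * ‖v‖ ^ ((d:ℝ) + ϑ) * π v :=
              mul_le_mul_of_nonneg_right h2 (hπ0 v).le
          _ = 2 ^ ((d:ℝ) + ϑ) * (‖v‖ ^ ((d:ℝ) + ϑ) * π v) := by ring
          _ ≤ _ := mul_le_mul_of_nonneg_left (hM v) (by positivity)
      rcases le_total ‖x‖ ‖y‖ with h | h
      · have := tri x y h
        nlinarith
      · have := tri y x h
        rw [norm_sub_rev] at this
        nlinarith
    calc _ = nlKernel (d + ϑ) φ (x, y) * (‖x - y‖ ^ ((d:ℝ) + ϑ) * (π x * π y)) := by ring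
      _ ≤ nlKernel (d + ϑ) φ (x, y) * (2 ^ ((d:ℝ) + ϑ) * M * (π x + π y)) :=
          mul_le_mul_of_nonneg_left main hK
      _ = _ := by ring

lemma tail_small (π : EuclideanSpace ℝ (Fin d) → ℝ) (hπi : Integrable π) (ε : ℝ) (hε : 0 < ε) :
    ∃ R : ℝ, 0 < R ∧ ∫ x in {x | R < ‖x‖}, π x < ε := by
  have h := tendsto_setIntegral_of_antitone (f := π) (μ := volume)
    (s := fun R : ℝ => {x : EuclideanSpace ℝ (Fin d) | R < ‖x‖})
    (fun R => measurableSet_lt measurable_const measurable_norm)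
    (fun a b hab x hx => lt_of_le_of_lt hab hx) ⟨0, hπi.integrableOn⟩
  have e : (⋂ n : ℝ, {x : EuclideanSpace ℝ (Fin d) | n < ‖x‖}) = ∅ := by
    ext x
    simp only [mem_iInter, mem_ofPred_eq, mem_empty_iff_false, iff_false, not_forall]
    exact ⟨‖x‖, lt_irrefl _⟩
  rw [e] at h
  simp only [Measure.restrict_empty, integral_zero_measure] at h
  obtain ⟨R, h1, h2⟩ := ((h.eventually (gt_mem_nhds hε)).and (eventually_gt_atTop 0)).exists
  exact ⟨R, h2, h1⟩

lemma exists_max_ball (π : EuclideanSpace ℝ (Fin d) → ℝ) (hπc : Continuous π) (R : ℝ) :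
    ∃ M, ∀ x, ‖x‖ ≤ R → π x ≤ M := by
  obtain ⟨M, hM⟩ := (isCompact_closedBall (0 : EuclideanSpace ℝ (Fin d)) R).bddAbove_image
    hπc.continuousOn
  exact ⟨M, fun x hx => hM ⟨x, by simpa using hx, rfl⟩⟩

lemma exists_min_ball (π : EuclideanSpace ℝ (Fin d) → ℝ) (hπc : Continuous π)
    (hπ0 : ∀ x, 0 < π x) (R : ℝ) (hR : 0 ≤ R) :
    ∃ m, 0 < m ∧ ∀ x, ‖x‖ ≤ R → m ≤ π x := by
  obtain ⟨z, hz, hm⟩ := (isCompact_closedBall (0 : EuclideanSpace ℝ (Fin d)) R).exists_isMinOn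
    ⟨0, by simpa using hR⟩ hπc.continuousOn
  exact ⟨π z, hπ0 z, fun x hx => hm (by simpa using hx)⟩

lemma weak_poincare (ϑ : ℝ) (hϑ : 0 < ϑ) (π : EuclideanSpace ℝ (Fin d) → ℝ) (hπc : Continuous π)
    (hπ0 : ∀ x, 0 < π x) (hπi : Integrable π) (hπ1 : ∫ x, π x = 1) (r : ℝ) (hr : 0 < r) :
    ∃ C : ℝ, 0 < C ∧
        ∀ φ : EuclideanSpace ℝ (Fin d) → ℝ, Measurable φ →
          (∃ Cb : ℝ, ∀ x, |φ x| ≤ Cb) →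
          dirichletFinite d ϑ π φ →
          (∫ x, (φ x)^2 * π x) - (∫ x, φ x * π x)^2 ≤ C * dirichletForm d ϑ π φ
            + r * (⨆ x, |φ x|)^2 := by
  have hs : 0 < (d:ℝ) + ϑ := by positivity
  obtain ⟨R, hR, hRt⟩ := tail_small π hπi (r / 4) (by positivity)
  obtain ⟨M, hM⟩ := exists_max_ball π hπc R
  have hM0 : 0 ≤ M := (hπ0 0).le.trans (hM 0 (by simpa using hR.le))
  have hC0 : 0 ≤ (2 * R) ^ ((d:ℝ) + ϑ) * M := by positivity
  refine ⟨(2 * R) ^ ((d:ℝ) + ϑ) * M + 1, by positivity, fun φ hφ ⟨Cb, hCb⟩ hE => ?_⟩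
  set S := ⨆ x, |φ x| with hS
  have hSx : ∀ x, |φ x| ≤ S := fun x => le_ciSup (f := fun x => |φ x|)
    ⟨Cb, by rintro _ ⟨x, rfl⟩; exact hCb x⟩ x
  have hms : MeasurableSet {x : EuclideanSpace ℝ (Fin d) | R < ‖x‖} :=
    measurableSet_lt measurable_const measurable_norm
  have hi : Integrable (({x : EuclideanSpace ℝ (Fin d) | R < ‖x‖}).indicator π) :=
    hπi.indicator hms
  have := var_bound ϑ π φ (fun x => 4 * S^2 * ({x | R < ‖x‖}).indicator π x) hπi hπ1 hφ Cb hCb hE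
    ((2 * R) ^ ((d:ℝ) + ϑ) * M) (hi.const_mul _) ?_
  · have h0 := dirichletForm_nonneg ϑ π φ hπ0
    rw [integral_const_mul, integral_indicator hms] at this
    nlinarith [sq_nonneg S]
  · intro x y
    have hK := nlKernel_nonneg (d + ϑ) φ (x, y)
    have e := nlKernel_mul (d + ϑ) φ (x, y)
    simp only at e
    have px := hπ0 x
    have py := hπ0 y
    have hind : ∀ z, 0 ≤ ({x | R < ‖x‖}).indicator π z :=
      fun z => indicator_nonneg (fun _ _ => (hπ0 _).le) z
    have hsq : (φ x - φ y)^2 ≤ 4 * S^2 := by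
      have h1 := hSx x
      have h2 := hSx y
      have : |φ x - φ y| ≤ 2 * S := (abs_sub _ _).trans (by linarith)
      calc _ = |φ x - φ y| ^ 2 := (sq_abs _).symm
        _ ≤ (2 * S)^2 := pow_le_pow_left₀ (abs_nonneg _) this 2
        _ = _ := by ring
    have hA : 0 ≤ (2 * R) ^ ((d:ℝ) + ϑ) * M * (nlKernel (d + ϑ) φ (x, y) * (π x + π y)) := by
      positivity
    have hP : 0 ≤ 4 * S^2 := by positivity
    have hB1 : 0 ≤ 4 * S^2 * ({x | R < ‖x‖}).indicator π x * π y :=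
      mul_nonneg (mul_nonneg hP (hind x)) py.le
    have hB2 : 0 ≤ π x * (4 * S^2 * ({x | R < ‖x‖}).indicator π y) :=
      mul_nonneg px.le (mul_nonneg hP (hind y))
    have hbig : (φ x - φ y)^2 * (π x * π y) ≤ 4 * S^2 * (π x * π y) :=
      mul_le_mul_of_nonneg_right hsq (by positivity)
    by_cases hx : R < ‖x‖
    · have : ({x | R < ‖x‖}).indicator π x = π x := indicator_of_mem (by exact hx) _
      rw [this] at hB1 ⊢
      linarith
    by_cases hy : R < ‖y‖
    · have : ({x | R < ‖x‖}).indicator π y = π y := indicator_of_mem (by exact hy) _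
      rw [this] at hB2 ⊢
      linarith
    push Not at hx hy
    have main : ‖x - y‖ ^ ((d:ℝ) + ϑ) * (π x * π y) ≤ (2 * R) ^ ((d:ℝ) + ϑ) * M * (π x + π y) := by
      have h1 : ‖x - y‖ ≤ 2 * R := (norm_sub_le x y).trans (by linarith)
      have h2 : ‖x - y‖ ^ ((d:ℝ) + ϑ) ≤ (2 * R) ^ ((d:ℝ) + ϑ) :=
        Real.rpow_le_rpow (norm_nonneg _) h1 hs.le
      have h3 : π x * π y ≤ M * (π x + π y) := by nlinarith [hM x hx]
      calc _ ≤ (2 * R) ^ ((d:ℝ) + ϑ) * (M * (π x + π y)) :=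
            mul_le_mul h2 h3 (by positivity) (by positivity)
        _ = _ := by ring
    calc _ = nlKernel (d + ϑ) φ (x, y) * (‖x - y‖ ^ ((d:ℝ) + ϑ) * (π x * π y)) := by rw [e]; ring
      _ ≤ nlKernel (d + ϑ) φ (x, y) * ((2 * R) ^ ((d:ℝ) + ϑ) * M * (π x + π y)) :=
          mul_le_mul_of_nonneg_left main hK
      _ = (2 * R) ^ ((d:ℝ) + ϑ) * M * (nlKernel (d + ϑ) φ (x, y) * (π x + π y)) := by ring
      _ ≤ _ := by linarith

lemma local_super (ϑ : ℝ) (hϑ : 0 < ϑ) (π : EuclideanSpace ℝ (Fin d) → ℝ)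
    (hπ0 : ∀ x, 0 < π x) (hπi : Integrable π) (R h m : ℝ) (h0 : 0 < h) (h1 : h ≤ 1)
    (hm : 0 < m) (hmx : ∀ x, ‖x‖ ≤ R + 1 → m ≤ π x)
    (φ : EuclideanSpace ℝ (Fin d) → ℝ) (hφ : Measurable φ) (Cb : ℝ) (hCb : ∀ x, |φ x| ≤ Cb)
    (hE : dirichletFinite d ϑ π φ) :
    volume.real (Metric.ball (0 : EuclideanSpace ℝ (Fin d)) 1) * h ^ d *
      ∫ x in Metric.closedBall (0 : EuclideanSpace ℝ (Fin d)) R, (φ x)^2 * π x ≤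
    h ^ ((d:ℝ) + ϑ) * dirichletForm d ϑ π φ + 2 / m * (∫ x, |φ x| * π x)^2 := by
  have hs : 0 < (d:ℝ) + ϑ := by positivity
  obtain ⟨i2, -, e2, -⟩ := energy_facts ϑ π φ hE
  have j1 : Integrable (fun x => |φ x| * π x) := integrable_bdd π (fun x => |φ x|) hπi
    (by fun_prop) Cb (by simpa using hCb)
  have j2 : Integrable (fun x => (φ x)^2 * π x) :=
    integrable_bdd π (fun x => φ x ^ 2) hπi (hφ.pow_const 2) (Cb^2) (fun x => by
      rw [abs_pow]; exact pow_le_pow_left₀ (abs_nonneg _) (hCb x) 2)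
  set B := Metric.closedBall (0 : EuclideanSpace ℝ (Fin d)) R with hB
  have hBm : MeasurableSet B := Metric.isClosed_closedBall.measurableSet
  set F : EuclideanSpace ℝ (Fin d) → ℝ := B.indicator (fun x => (φ x)^2 * π x) with hF
  have hFi : Integrable F := j2.indicator hBm
  have hF0 : ∀ x, 0 ≤ F x := fun x =>
    indicator_nonneg (fun y _ => mul_nonneg (sq_nonneg _) (hπ0 y).le) x
  set D : Set (EuclideanSpace ℝ (Fin d) × EuclideanSpace ℝ (Fin d)) := {p | ‖p.1 - p.2‖ ≤ h} with hD
  have hDm : MeasurableSet D := measurableSet_le (by fun_prop) measurable_const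
  set L : EuclideanSpace ℝ (Fin d) × EuclideanSpace ℝ (Fin d) → ℝ :=
    D.indicator (fun p => F p.2) with hL
  have hone : Integrable ((Metric.closedBall (0 : EuclideanSpace ℝ (Fin d)) (R+1)).indicator
      (fun _ => (1:ℝ))) :=
    (integrable_indicator_iff Metric.isClosed_closedBall.measurableSet).2
      (integrableOn_const (isCompact_closedBall _ _).measure_lt_top.ne)
  have hprod := hone.mul_prod hFi
  rw [Measure.volume_eq_prod] at i2 e2
  have hLi : Integrable L ((volume : Measure (EuclideanSpace ℝ (Fin d))).prod volume) := by
    refine hprod.mono' ?_ (Eventually.of_forall fun p => ?_)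
    · exact (hFi.aestronglyMeasurable.comp_snd).indicator hDm
    · by_cases hp : p ∈ D
      · rw [hL, indicator_of_mem hp, Real.norm_of_nonneg (hF0 _)]
        by_cases hy : p.2 ∈ B
        · have hx : p.1 ∈ Metric.closedBall (0 : EuclideanSpace ℝ (Fin d)) (R+1) := by
            have a : ‖p.1 - p.2‖ ≤ h := hp
            have c : ‖p.2‖ ≤ R := by simpa [hB] using hy
            have := norm_add_le (p.1 - p.2) p.2
            rw [sub_add_cancel] at this
            simp only [mem_closedBall_zero_iff]
            linarith
          rw [indicator_of_mem hx, one_mul]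
        · rw [hF, indicator_of_notMem hy]; simp
      · rw [hL, indicator_of_notMem hp, norm_zero]
        exact mul_nonneg (indicator_nonneg (fun _ _ => zero_le_one) _) (hF0 _)
  have hLint : ∫ p, L p ∂((volume : Measure (EuclideanSpace ℝ (Fin d))).prod volume) =
      volume.real (Metric.ball (0 : EuclideanSpace ℝ (Fin d)) 1) * h ^ d * ∫ y, F y := by
    rw [integral_prod_symm _ hLi, ← integral_const_mul]
    congr 1
    funext y
    have : (fun x => L (x, y)) = (Metric.closedBall y h).indicator (fun _ => F y) := by
      funext x
      simp only [hL, hD, indicator, mem_ofPred_eq, Metric.mem_closedBall, dist_eq_norm]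
    rw [this, integral_indicator Metric.isClosed_closedBall.measurableSet, setIntegral_const,
      Measure.addHaar_real_closedBall _ _ h0.le, finrank_euclideanSpace_fin, smul_eq_mul]
    ring
  have k := j1.mul_prod j1
  have key : ∫ p, L p ∂((volume : Measure (EuclideanSpace ℝ (Fin d))).prod volume) ≤
      ∫ p, (h ^ ((d:ℝ) + ϑ) * (nlKernel (d + ϑ) φ p * π p.2) +
        2 / m * (|φ p.1| * π p.1 * (|φ p.2| * π p.2)))
        ∂((volume : Measure (EuclideanSpace ℝ (Fin d))).prod volume) := by
    refine integral_mono hLi ((i2.const_mul _).add (k.const_mul _)) fun p => ?_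
    have px := hπ0 p.1
    have py := hπ0 p.2
    have hK := nlKernel_nonneg (d + ϑ) φ p
    have hr : 0 ≤ h ^ ((d:ℝ) + ϑ) * (nlKernel (d + ϑ) φ p * π p.2) +
        2 / m * (|φ p.1| * π p.1 * (|φ p.2| * π p.2)) := by positivity
    simp only
    by_cases hp : p ∈ D
    · rw [hL, indicator_of_mem hp]
      by_cases hy : p.2 ∈ B
      · have a : ‖p.1 - p.2‖ ≤ h := hp
        have hx : ‖p.1‖ ≤ R + 1 := by
          have c : ‖p.2‖ ≤ R := by simpa [hB] using hy
          have := norm_add_le (p.1 - p.2) p.2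
          rw [sub_add_cancel] at this
          linarith
        rw [hF, indicator_of_mem hy]
        have e := nlKernel_mul (d + ϑ) φ p
        have s1 : (φ p.1 - φ p.2)^2 ≤ h ^ ((d:ℝ) + ϑ) * nlKernel (d + ϑ) φ p := by
          rw [e, mul_comm]
          exact mul_le_mul_of_nonneg_right (Real.rpow_le_rpow (norm_nonneg _) a hs.le) hK
        have s2 : |φ p.1| ≤ 1 / m * (|φ p.1| * π p.1) := by
          rw [one_div, inv_mul_eq_div, le_div_iff₀ hm]
          exact mul_le_mul_of_nonneg_left (hmx _ hx) (abs_nonneg _)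
        have s3 : (φ p.2)^2 ≤ (φ p.1 - φ p.2)^2 + 2 * (|φ p.1| * |φ p.2|) := by
          rw [← abs_mul]
          nlinarith [le_abs_self (φ p.1 * φ p.2), sq_nonneg (φ p.1)]
        have s4 : |φ p.1| * |φ p.2| ≤ 1 / m * (|φ p.1| * π p.1) * |φ p.2| :=
          mul_le_mul_of_nonneg_right s2 (abs_nonneg _)
        calc (φ p.2)^2 * π p.2 ≤ (h ^ ((d:ℝ) + ϑ) * nlKernel (d + ϑ) φ p
              + 2 * (1 / m * (|φ p.1| * π p.1) * |φ p.2|)) * π p.2 :=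
              mul_le_mul_of_nonneg_right (by linarith) py.le
          _ = _ := by ring
      · rw [hF, indicator_of_notMem hy]; exact hr
    · rw [hL, indicator_of_notMem hp]; exact hr
  rw [hLint, integral_add (i2.const_mul _) (k.const_mul _), integral_const_mul, integral_const_mul,
    e2, integral_prod_mul (fun x => |φ x| * π x) (fun x => |φ x| * π x),
    hF, integral_indicator hBm] at key
  linarith

lemma far_super (ϑ : ℝ) (hϑ : 0 < ϑ) (π : EuclideanSpace ℝ (Fin d) → ℝ)
    (hπ0 : ∀ x, 0 < π x) (hπi : Integrable π) (hπ1 : ∫ x, π x = 1)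
    (R ε m : ℝ) (hR : 1 ≤ R)
    (hm : 0 < m) (hmx : ∀ x, ‖x‖ ≤ 1 → m ≤ π x)
    (hε : ∀ x, R ≤ ‖x‖ → ‖x‖ ^ ((d:ℝ) + ϑ) * π x ≤ ε)
    (φ : EuclideanSpace ℝ (Fin d) → ℝ) (hφ : Measurable φ) (Cb : ℝ) (hCb : ∀ x, |φ x| ≤ Cb)
    (hE : dirichletFinite d ϑ π φ) (hε0 : 0 ≤ ε) :
    volume.real (Metric.ball (0 : EuclideanSpace ℝ (Fin d)) 1) *
      ∫ x in (Metric.closedBall (0 : EuclideanSpace ℝ (Fin d)) R)ᶜ, (φ x)^2 * π x ≤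
    2 * 2 ^ ((d:ℝ) + ϑ) / m * ε * dirichletForm d ϑ π φ
      + 2 / m * ∫ x in Metric.closedBall (0 : EuclideanSpace ℝ (Fin d)) R, (φ x)^2 * π x := by
  have hs : 0 < (d:ℝ) + ϑ := by positivity
  obtain ⟨-, i1, -, e1⟩ := energy_facts ϑ π φ hE
  have j2 : Integrable (fun x => (φ x)^2 * π x) :=
    integrable_bdd π (fun x => φ x ^ 2) hπi (hφ.pow_const 2) (Cb^2) (fun x => by
      rw [abs_pow]; exact pow_le_pow_left₀ (abs_nonneg _) (hCb x) 2)
  set B := Metric.closedBall (0 : EuclideanSpace ℝ (Fin d)) R with hB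
  have hBm : MeasurableSet B := Metric.isClosed_closedBall.measurableSet
  set U := Metric.ball (0 : EuclideanSpace ℝ (Fin d)) 1 with hU
  have hUm : MeasurableSet U := Metric.isOpen_ball.measurableSet
  have hone : Integrable (U.indicator (fun _ => (1:ℝ))) :=
    (integrable_indicator_iff hUm).2 (integrableOn_const measure_ball_lt_top.ne)
  have g1 := hone.mul_prod (j2.indicator hBm.compl)
  have g2 := (j2.indicator hBm).mul_prod hπi
  rw [Measure.volume_eq_prod] at i1 e1
  have hF0 : ∀ x, 0 ≤ B.indicator (fun x => (φ x)^2 * π x) x := fun x =>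
    indicator_nonneg (fun y _ => mul_nonneg (sq_nonneg _) (hπ0 y).le) x
  have key : ∫ p, U.indicator (fun _ => (1:ℝ)) p.1 * Bᶜ.indicator (fun x => (φ x)^2 * π x) p.2
        ∂((volume : Measure (EuclideanSpace ℝ (Fin d))).prod volume) ≤
      ∫ p, (2 * 2 ^ ((d:ℝ) + ϑ) / m * ε * (nlKernel (d + ϑ) φ p * π p.1) +
        2 / m * (B.indicator (fun x => (φ x)^2 * π x) p.1 * π p.2))
        ∂((volume : Measure (EuclideanSpace ℝ (Fin d))).prod volume) := by
    refine integral_mono g1 ((i1.const_mul _).add (g2.const_mul _)) fun p => ?_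
    have px := hπ0 p.1
    have py := hπ0 p.2
    have hK := nlKernel_nonneg (d + ϑ) φ p
    have hr : 0 ≤ 2 * 2 ^ ((d:ℝ) + ϑ) / m * ε * (nlKernel (d + ϑ) φ p * π p.1) +
        2 / m * (B.indicator (fun x => (φ x)^2 * π x) p.1 * π p.2) :=
      add_nonneg (by positivity) (mul_nonneg (by positivity) (mul_nonneg (hF0 _) py.le))
    simp only
    by_cases hx : p.1 ∈ U
    swap
    · rw [indicator_of_notMem hx, zero_mul]; exact hr
    by_cases hy : p.2 ∈ B
    · rw [indicator_of_notMem (s := Bᶜ) (by simpa using hy), mul_zero]; exact hr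
    have hx' : ‖p.1‖ < 1 := by simpa [hU] using hx
    have hy' : R < ‖p.2‖ := by simpa [hB] using hy
    have hxB : p.1 ∈ B := by simp [hB]; linarith
    rw [indicator_of_mem hx, indicator_of_mem (s := Bᶜ) hy, indicator_of_mem hxB, one_mul]
    have e := nlKernel_mul (d + ϑ) φ p
    have hmp : 1 ≤ 1 / m * π p.1 := by
      rw [one_div, inv_mul_eq_div, le_div_iff₀ hm, one_mul]
      exact hmx _ hx'.le
    have s1 : ‖p.1 - p.2‖ ^ ((d:ℝ) + ϑ) * π p.2 ≤ 2 ^ ((d:ℝ) + ϑ) * ε := by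
      have h1 : ‖p.1 - p.2‖ ≤ 2 * ‖p.2‖ := (norm_sub_le _ _).trans (by linarith)
      have h2 : ‖p.1 - p.2‖ ^ ((d:ℝ) + ϑ) ≤ 2 ^ ((d:ℝ) + ϑ) * ‖p.2‖ ^ ((d:ℝ) + ϑ) := by
        rw [← Real.mul_rpow (by norm_num) (norm_nonneg _)]
        exact Real.rpow_le_rpow (norm_nonneg _) h1 hs.le
      calc _ ≤ 2 ^ ((d:ℝ) + ϑ) * ‖p.2‖ ^ ((d:ℝ) + ϑ) * π p.2 :=
            mul_le_mul_of_nonneg_right h2 py.le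
        _ = 2 ^ ((d:ℝ) + ϑ) * (‖p.2‖ ^ ((d:ℝ) + ϑ) * π p.2) := by ring
        _ ≤ _ := mul_le_mul_of_nonneg_left (hε _ hy'.le) (by positivity)
    have s2 : (φ p.1 - φ p.2)^2 * π p.2 ≤ nlKernel (d + ϑ) φ p * (2 ^ ((d:ℝ) + ϑ) * ε) := by
      rw [e, mul_assoc]
      exact mul_le_mul_of_nonneg_left s1 hK
    have s3 : nlKernel (d + ϑ) φ p * (2 ^ ((d:ℝ) + ϑ) * ε) ≤
        nlKernel (d + ϑ) φ p * (2 ^ ((d:ℝ) + ϑ) * ε) * (1 / m * π p.1) :=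
      le_mul_of_one_le_right (by positivity) hmp
    have s4 : (φ p.1)^2 * π p.2 ≤ (φ p.1)^2 * π p.2 * (1 / m * π p.1) :=
      le_mul_of_one_le_right (by positivity) hmp
    have s5 : (φ p.2)^2 * π p.2 ≤ (2 * (φ p.1 - φ p.2)^2 + 2 * (φ p.1)^2) * π p.2 :=
      mul_le_mul_of_nonneg_right (by nlinarith [sq_nonneg (2 * φ p.1 - φ p.2)]) py.le
    calc (φ p.2)^2 * π p.2 ≤ 2 * (nlKernel (d + ϑ) φ p * (2 ^ ((d:ℝ) + ϑ) * ε) * (1 / m * π p.1))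
          + 2 * ((φ p.1)^2 * π p.2 * (1 / m * π p.1)) := by linarith
      _ = _ := by ring
  rw [integral_add (i1.const_mul _) (g2.const_mul _), integral_const_mul, integral_const_mul,
    e1, integral_prod_mul (U.indicator (fun _ => (1:ℝ))) (Bᶜ.indicator (fun x => (φ x)^2 * π x)),
    integral_prod_mul (B.indicator (fun x => (φ x)^2 * π x)) π, hπ1,
    integral_indicator hBm, integral_indicator hBm.compl, integral_indicator hUm,
    setIntegral_const] at key
  simpa using key

lemma super_poincare (ϑ : ℝ) (hϑ : 0 < ϑ) (π : EuclideanSpace ℝ (Fin d) → ℝ) (hπc : Continuous π)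
    (hπ0 : ∀ x, 0 < π x) (hπi : Integrable π) (hπ1 : ∫ x, π x = 1)
    (htail : ∀ ε > 0, ∃ R : ℝ, ∀ x, R ≤ ‖x‖ → ‖x‖ ^ ((d:ℝ) + ϑ) * π x ≤ ε)
    (r : ℝ) (hr : 0 < r) :
    ∃ C : ℝ, 0 < C ∧
        ∀ φ : EuclideanSpace ℝ (Fin d) → ℝ, Measurable φ →
          (∃ Cb : ℝ, ∀ x, |φ x| ≤ Cb) →
          dirichletFinite d ϑ π φ →
          ∫ x, (φ x)^2 * π x ≤ r * dirichletForm d ϑ π φ + C * (∫ x, |φ x| * π x)^2 := by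
  obtain ⟨m, hm, hmx⟩ := exists_min_ball π hπc hπ0 1 zero_le_one
  set V := volume.real (Metric.ball (0 : EuclideanSpace ℝ (Fin d)) 1) with hV
  have hV0 : 0 < V := ENNReal.toReal_pos (Metric.measure_ball_pos _ _ one_pos).ne' measure_ball_lt_top.ne
  set ε : ℝ := r / 2 * V * m / (2 * 2 ^ ((d:ℝ) + ϑ)) with hε
  have hε0 : 0 < ε := by positivity
  obtain ⟨R₀, hR₀⟩ := htail ε hε0
  set R := max R₀ 1
  obtain ⟨m', hm', hmx'⟩ := exists_min_ball π hπc hπ0 (R + 1) (by positivity)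
  -- constant multiplying the local part
  set A : ℝ := 1 + 2 / m / V with hA
  have hA0 : 0 < A := by positivity
  obtain ⟨h, h0, h1, hh⟩ : ∃ h : ℝ, 0 < h ∧ h ≤ 1 ∧ A * (h ^ ϑ / V) ≤ r / 2 := by
    have ht : Tendsto (fun h : ℝ => A * (h ^ ϑ / V)) (𝓝[>] 0) (𝓝 (A * (0 / V))) := by
      have : Tendsto (fun h : ℝ => h ^ ϑ) (𝓝[>] 0) (𝓝 0) := by
        have := (Real.continuousAt_rpow_const 0 ϑ (Or.inr hϑ.le)).tendsto
        rw [Real.zero_rpow hϑ.ne'] at this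
        exact this.mono_left nhdsWithin_le_nhds
      exact (this.div_const V).const_mul A
    rw [zero_div, mul_zero] at ht
    have e1 := ht.eventually (gt_mem_nhds (show (0:ℝ) < r / 2 by positivity))
    have e2 : ∀ᶠ h : ℝ in 𝓝[>] 0, h < 1 := (gt_mem_nhds one_pos).filter_mono nhdsWithin_le_nhds
    obtain ⟨h, ⟨a, c⟩, e⟩ := ((e1.and e2).and self_mem_nhdsWithin).exists
    exact ⟨h, e, c.le, a.le⟩
  refine ⟨A * (2 / m' / (V * h ^ d)), by positivity, fun φ hφ ⟨Cb, hCb⟩ hE => ?_⟩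
  have l := local_super ϑ hϑ π hπ0 hπi R h m' h0 h1 hm' hmx' φ hφ Cb hCb hE
  have g := far_super ϑ hϑ π hπ0 hπi hπ1 R ε m (le_max_right _ _) hm hmx
    (fun x hx => hR₀ x ((le_max_left _ _).trans hx)) φ hφ Cb hCb hE hε0.le
  have j2 : Integrable (fun x => (φ x)^2 * π x) :=
    integrable_bdd π (fun x => φ x ^ 2) hπi (hφ.pow_const 2) (Cb^2) (fun x => by
      rw [abs_pow]; exact pow_le_pow_left₀ (abs_nonneg _) (hCb x) 2)
  have hsplit := integral_add_compl (μ := volume)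
    (Metric.isClosed_closedBall (x := (0 : EuclideanSpace ℝ (Fin d))) (ε := R)).measurableSet j2
  have hE0 := dirichletForm_nonneg ϑ π φ hπ0
  set E := dirichletForm d ϑ π φ
  set I := ∫ x in Metric.closedBall (0 : EuclideanSpace ℝ (Fin d)) R, (φ x)^2 * π x
  set J := ∫ x in (Metric.closedBall (0 : EuclideanSpace ℝ (Fin d)) R)ᶜ, (φ x)^2 * π x
  set Q := (∫ x, |φ x| * π x)^2
  rw [← hsplit]
  have l' : I ≤ h ^ ϑ / V * E + 2 / m' / (V * h ^ d) * Q := by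
    have e : h ^ ((d:ℝ) + ϑ) = h ^ d * h ^ ϑ := by
      rw [Real.rpow_add h0, Real.rpow_natCast]
    rw [← hV, e] at l
    have : h ^ ϑ / V * E + 2 / m' / (V * h ^ d) * Q
        = (h ^ d * h ^ ϑ * E + 2 / m' * Q) / (V * h ^ d) := by
      have := pow_pos h0 d
      field_simp
    rw [this, le_div_iff₀ (by positivity)]
    linarith
  have g' : J ≤ r / 2 * E + 2 / m / V * I := by
    have e : 2 * 2 ^ ((d:ℝ) + ϑ) / m * ε = r / 2 * V := by
      rw [hε]; field_simp
    rw [← hV, e] at g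
    have : r / 2 * E + 2 / m / V * I = (r / 2 * V * E + 2 / m * I) / V := by field_simp
    rw [this, le_div_iff₀ hV0]
    linarith
  have t1 : A * I ≤ A * (h ^ ϑ / V * E + 2 / m' / (V * h ^ d) * Q) :=
    mul_le_mul_of_nonneg_left l' hA0.le
  have t2 : A * (h ^ ϑ / V) * E ≤ r / 2 * E := mul_le_mul_of_nonneg_right hh hE0
  have t3 : A * I = I + 2 / m / V * I := by rw [hA]; ring
  calc I + J ≤ A * I + r / 2 * E := by linarith
    _ ≤ A * (h ^ ϑ / V) * E + A * (2 / m' / (V * h ^ d)) * Q + r / 2 * E := by linarith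
    _ ≤ _ := by linarith

end Helpers
/-- Proposition 5.4 of the paper: under Assumptions A0 and A3 (strong
convexity at infinity with parameter `ρ`), with `π ∝ e^{−f}` and the nonlocal Dirichlet
form `E`:
(1) if `β ∈ (1,2)`, or `β = 2` and `ϑ < ρ b⁻¹/2`, then `π` satisfies a super Poincaré
inequality;
(2) if `β = 2`, `ϑ = ρ b⁻¹/2` and `d ∈ {1,2}`, then `π` satisfies a Poincaré inequality;
(3) if `β = 2` and either (`ϑ = ρ b⁻¹/2` with `d ≥ 3`) or `ϑ > ρ b⁻¹/2`, then `π`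
satisfies a weak Poincaré inequality. -/
theorem poincare_trichotomy_from_strong_convexity
    (d : ℕ) (hd : 0 < d) (b β ϑ : ℝ) (hb : 0 < b) (hβ : β ∈ Ioc (1:ℝ) 2)
    (hϑ : ϑ ∈ Ioo (0:ℝ) 2)
    (f : EuclideanSpace ℝ (Fin d) → ℝ) (f0 : ℝ → ℝ)
    (hiso : ∀ x : EuclideanSpace ℝ (Fin d), f x = f0 ‖x‖)
    (hf0 : ContDiff ℝ 2 f0)
    (hint : Integrable (fun x : EuclideanSpace ℝ (Fin d) => Real.exp (-(f x))))
    (N3 ρ : ℝ) (hN3 : 0 < N3) (hρ : 0 < ρ)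
    (hA3 : ∀ r : ℝ, N3 < r →
      ρ < deriv f0 (Real.exp (b * r ^ β)) * deriv (fun s => Real.exp (b * s ^ β)) r / r
            - b * β * d * r ^ (β - 2) + ((d:ℝ) - β) * r ^ (-2 : ℝ) ∧
      ρ < deriv (deriv f0) (Real.exp (b * r ^ β)) * (deriv (fun s => Real.exp (b * s ^ β)) r)^2
            + deriv f0 (Real.exp (b * r ^ β)) * deriv (deriv (fun s => Real.exp (b * s ^ β))) r
            - b * β * (β - 1) * d * r ^ (β - 2) - ((d:ℝ) - β) * r ^ (-2 : ℝ)) :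
    ((β < 2 ∨ (β = 2 ∧ ϑ < ρ / b / 2)) →
      ∃ βt : ℝ → ℝ, (∀ r : ℝ, 0 < r → 0 < βt r) ∧
        ∀ r : ℝ, 0 < r →
        ∀ φ : EuclideanSpace ℝ (Fin d) → ℝ, Measurable φ →
          (∃ Cb : ℝ, ∀ x, |φ x| ≤ Cb) →
          dirichletFinite d ϑ (targetDensity d f) φ →
          ∫ x, (φ x)^2 * targetDensity d f x
            ≤ r * dirichletForm d ϑ (targetDensity d f) φ
              + βt r * (∫ x, |φ x| * targetDensity d f x)^2) ∧
    ((β = 2 ∧ ϑ = ρ / b / 2 ∧ (d = 1 ∨ d = 2)) →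
      ∃ C : ℝ, 0 < C ∧
        ∀ φ : EuclideanSpace ℝ (Fin d) → ℝ, Measurable φ →
          (∃ Cb : ℝ, ∀ x, |φ x| ≤ Cb) →
          dirichletFinite d ϑ (targetDensity d f) φ →
          (∫ x, (φ x)^2 * targetDensity d f x)
              - (∫ x, φ x * targetDensity d f x)^2
            ≤ C * dirichletForm d ϑ (targetDensity d f) φ) ∧
    ((β = 2 ∧ ((ϑ = ρ / b / 2 ∧ 3 ≤ d) ∨ ρ / b / 2 < ϑ)) →
      ∃ αt : ℝ → ℝ, (∀ r : ℝ, 0 < r → 0 < αt r) ∧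
        ∀ r : ℝ, 0 < r →
        ∀ φ : EuclideanSpace ℝ (Fin d) → ℝ, Measurable φ →
          (∃ Cb : ℝ, ∀ x, |φ x| ≤ Cb) →
          dirichletFinite d ϑ (targetDensity d f) φ →
          (∫ x, (φ x)^2 * targetDensity d f x)
              - (∫ x, φ x * targetDensity d f x)^2
            ≤ αt r * dirichletForm d ϑ (targetDensity d f) φ
              + r * (⨆ x, |φ x|)^2) := by
  have hβ0 : 0 < β := by linarith [hβ.1]
  have hϑ0 : 0 < ϑ := hϑ.1
  have hfc : Continuous f := by
    have : f = fun x => f0 ‖x‖ := funext hiso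
    rw [this]
    exact hf0.continuous.comp continuous_norm
  have hZ : 0 < ∫ z, Real.exp (-(f z)) := integral_exp_pos hint
  set Z := ∫ z, Real.exp (-(f z)) with hZdef
  have hπd : ∀ x, targetDensity d f x = Real.exp (-(f x)) / Z := fun x => rfl
  have hπc : Continuous (targetDensity d f) := by
    have : targetDensity d f = fun x => Real.exp (-(f x)) / Z := rfl
    rw [this]
    fun_prop
  have hπ0 : ∀ x, 0 < targetDensity d f x := fun x => by rw [hπd]; positivity
  have hπi : Integrable (targetDensity d f) := hint.div_const Z
  have hπ1 : ∫ x, targetDensity d f x = 1 := by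
    simp_rw [hπd]
    rw [integral_div, ← hZdef, div_self hZ.ne']
  obtain ⟨c, hc⟩ := tail_lower d b β f0 hf0 N3 ρ hN3 (fun r hr => (hA3 r hr).1)
  -- pointwise tail control
  have tail : ∀ T : ℝ, N3 + 1 ≤ T → ∀ M : ℝ,
      (∀ r, T ≤ r → Real.exp (b * ϑ * r ^ β - ρ * r^2 / 2 + (d - β) * Real.log r - c) ≤ M) →
      ∀ x : EuclideanSpace ℝ (Fin d), Real.exp (b * T ^ β) ≤ ‖x‖ →
        ‖x‖ ^ ((d:ℝ) + ϑ) * targetDensity d f x ≤ M / Z := by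
    intro T hT M hM x hx
    obtain ⟨r, hr, e⟩ := radius_param b β hb hβ0 T (by linarith) ‖x‖ hx
    rw [hπd, hiso, ← mul_div_assoc, e]
    refine div_le_div_of_nonneg_right ?_ hZ.le
    exact (tail_exp_bound d b β ϑ c ρ r _ (hc r (hT.trans hr))).trans (hM r hr)
  refine ⟨fun h => ?_, fun h => ?_, fun h => ?_⟩
  · have htail : ∀ ε > 0, ∃ R : ℝ, ∀ x : EuclideanSpace ℝ (Fin d), R ≤ ‖x‖ →
        ‖x‖ ^ ((d:ℝ) + ϑ) * targetDensity d f x ≤ ε := by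
      intro ε hε
      have ht := Real.tendsto_exp_atBot.comp (exponent_tendsto b β ϑ ρ (d - β) c hρ hb h)
      have hev := ht.eventually (gt_mem_nhds (show 0 < ε * Z by positivity))
      obtain ⟨T, hT⟩ := eventually_atTop.1 hev
      refine ⟨Real.exp (b * (max T (N3 + 1)) ^ β), fun x hx => ?_⟩
      have := tail (max T (N3 + 1)) (le_max_right _ _) (ε * Z)
        (fun r hr => (hT r ((le_max_left _ _).trans hr)).le) x hx
      rwa [mul_div_cancel_right₀ _ hZ.ne'] at this
    have hS := super_poincare ϑ hϑ0 (targetDensity d f) hπc hπ0 hπi hπ1 htail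
    choose! C hC hC' using hS
    exact ⟨C, hC, hC'⟩
  · obtain ⟨h2, hϑe, hd2⟩ := h
    have hd2' : (d:ℝ) - β ≤ 0 := by
      rcases hd2 with h | h <;> rw [h, h2] <;> norm_num
    have hbϑ : b * ϑ = ρ / 2 := by rw [hϑe]; field_simp
    have h1 := tail (N3 + 1) le_rfl (Real.exp (-c)) (fun r hr => by
      rw [Real.exp_le_exp]
      have hl : 0 ≤ Real.log r := Real.log_nonneg (by linarith)
      have e : r ^ β = r ^ 2 := by rw [h2]; norm_cast
      rw [e, hbϑ]
      have := mul_nonneg_of_nonpos_of_nonpos hd2' (neg_nonpos.2 hl)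
      linarith)
    obtain ⟨M, hM⟩ := exists_max_ball (fun x => ‖x‖ ^ ((d:ℝ) + ϑ) * targetDensity d f x)
      ((continuous_norm.rpow_const (fun _ => Or.inr (by positivity))).mul hπc)
      (Real.exp (b * (N3 + 1) ^ β))
    exact poincare_of_tail ϑ hϑ0 (targetDensity d f) hπ0 hπi hπ1 (max M (Real.exp (-c) / Z))
      (fun x => by
        rcases le_total ‖x‖ (Real.exp (b * (N3 + 1) ^ β)) with h | h
        · exact (hM x h).trans (le_max_left _ _)
        · exact (h1 x h).trans (le_max_right _ _))
  · have hS := weak_poincare ϑ hϑ0 (targetDensity d f) hπc hπ0 hπi hπ1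
    choose! C hC hC' using hS
    exact ⟨C, hC, hC'⟩
end
end
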